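/- Let (R, m) be a quasi-Gorenstein Noetherian local ring of dimension d and let x ∈ m be a non-zerodivisor. Then R/xR is quasi-Gorenstein if and only if x does not belong to any attached prime of H_m^{d-1}(R). -/

import Mathlib

open CategoryTheory IsLocalRing Pointwise

noncomputable section

/-- `E` is an injective hull of `S ⧸ J` over `S`. -/
def IsInjHull (S : Type) [CommRing S] (J : Ideal S) (E : Type) [AddCommGroup E]
    [Module S E] : Prop :=
  Module.Injective S E ∧
    ∃ f : (S ⧸ J) →ₗ[S] E, Function.Injective f ∧
      ∀ N : Submodule S E, N ≠ ⊥ → N ⊓ LinearMap.range f ≠ ⊥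

/-- Local cohomology `H^i_J(M)`. -/
abbrev LC (S : Type) [CommRing S] (J : Ideal S) (i : ℕ) (M : ModuleCat S) : ModuleCat S :=
  (localCohomology J i).obj M

/-- Krull dimension of a module (dimension of its support). -/
def mdim (S : Type) [CommRing S] (M : Type) [AddCommGroup M] [Module S M] : WithBot ℕ∞ :=
  Order.krullDim (Module.support S M)

/-- Depth/grade of an ideal `J` on `M`: supremum of lengths of `M`-regular sequences in `J`. -/
def gradeI (S : Type) [CommRing S] (J : Ideal S) (M : Type) [AddCommGroup M]
    [Module S M] : ℕ∞ :=
  sSup {n : ℕ∞ | ∃ rs : List S, (rs.length : ℕ∞) = n ∧ (∀ r ∈ rs, r ∈ J) ∧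
    RingTheory.Sequence.IsRegular M rs}

/-- The local "height" of `M` at a prime `p`, i.e. `dim_{S_p} M_p`. -/
def htM (S : Type) [CommRing S] (M : Type) [AddCommGroup M] [Module S M]
    (p : PrimeSpectrum S) : WithBot ℕ∞ :=
  mdim (Localization.AtPrime p.asIdeal) (LocalizedModule p.asIdeal.primeCompl M)

/-- `ht_M(a) = inf { dim_{S_p} M_p : p ⊇ a, p ∈ Supp M }`. -/
def htI (S : Type) [CommRing S] (M : Type) [AddCommGroup M] [Module S M]
    (a : Ideal S) : WithBot ℕ∞ :=
  sInf {d | ∃ p ∈ Module.support S M, a ≤ p.asIdeal ∧ d = htM S M p}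

/-- Serre's condition `S_n` for the module `M`. -/
def Serre (S : Type) [CommRing S] (n : ℕ) (M : Type) [AddCommGroup M] [Module S M] : Prop :=
  ∀ (p : Ideal S) [p.IsPrime],
    min (n : WithBot ℕ∞)
        (mdim (Localization.AtPrime p) (LocalizedModule p.primeCompl M)) ≤
      (gradeI (Localization.AtPrime p) (IsLocalRing.maximalIdeal (Localization.AtPrime p))
        (LocalizedModule p.primeCompl M) : ℕ∞)

/-- Attached primes of `M` (Macdonald): primes of the form `Ann(M ⧸ N)`. -/
def attachedPrimes (S : Type) [CommRing S] (M : Type) [AddCommGroup M] [Module S M] :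
    Set (Ideal S) :=
  {p | p.IsPrime ∧ ∃ N : Submodule S M, p = Module.annihilator S (M ⧸ N)}

/-- `ω` is a canonical module of the `d`-dimensional module `M` over `(S, J)`:
its "Matlis dual" `Hom_S(ω, E)` is isomorphic to `H^d_J(M)`. -/
def IsCanonicalModule (S : Type) [CommRing S] (J : Ideal S) (d : ℕ)
    (M ω : ModuleCat S) : Prop :=
  Module.Finite S ω ∧ ∃ E : ModuleCat S, IsInjHull S J ↥E ∧
    Nonempty ((↥ω →ₗ[S] ↥E) ≃ₗ[S] ↥(LC S J d M))

/-- `(S, J)` is quasi-Gorenstein: `H^d_J(S)` is an injective hull of `S ⧸ J`, `d = dim S`. -/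
def IsQuasiGorensteinAt (S : Type) [CommRing S] (J : Ideal S) : Prop :=
  ∃ d : ℕ, ringKrullDim S = (d : WithBot ℕ∞) ∧
    ∃ E : ModuleCat S, IsInjHull S J ↥E ∧
      Nonempty (↥(LC S J d (ModuleCat.of S S)) ≃ₗ[S] ↥E)

/-- Totally reflexive modules. -/
def TotallyReflexive (S : Type) [CommRing S] (M : ModuleCat S) : Prop :=
  Module.Finite S ↥M ∧ Module.IsReflexive S ↥M ∧
    ∀ i : ℕ, 0 < i →
      Subsingleton ↥(((Ext S (ModuleCat S) i).obj (Opposite.op M)).obj (ModuleCat.of S S)) ∧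
      Subsingleton ↥(((Ext S (ModuleCat S) i).obj
        (Opposite.op (ModuleCat.of S (Module.Dual S ↥M)))).obj (ModuleCat.of S S))

/-- `G`-dimension at most `n`. -/
def GdimLE (S : Type) [CommRing S] : ℕ → ModuleCat S → Prop
  | 0, M => TotallyReflexive S M
  | n + 1, M => ∃ (G : ModuleCat S) (f : ↥G →ₗ[S] ↥M), Function.Surjective f ∧
      TotallyReflexive S G ∧ GdimLE S n (ModuleCat.of S (LinearMap.ker f))

/-- Injective dimension at most `n`. -/
def InjDimLE (S : Type) [CommRing S] : ℕ → ModuleCat S → Prop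
  | 0, M => Module.Injective S ↥M
  | n + 1, M => ∃ (E : ModuleCat S) (f : ↥M →ₗ[S] ↥E), Function.Injective f ∧
      Module.Injective S ↥E ∧ InjDimLE S n (ModuleCat.of S (↥E ⧸ LinearMap.range f))

/-- Injective dimension, as an element of `ℕ∞`. -/
def injDim (S : Type) [CommRing S] (M : ModuleCat S) : ℕ∞ :=
  sInf {n : ℕ∞ | ∃ k : ℕ, (k : ℕ∞) = n ∧ InjDimLE S k M}

/-- Minimal number of generators. -/
def genNumber (S : Type) [CommRing S] (M : Type) [AddCommGroup M] [Module S M] : ℕ∞ :=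
  sInf {n : ℕ∞ | ∃ s : Finset M, (s.card : ℕ∞) = n ∧ Submodule.span S (↑s : Set M) = ⊤}

/-- The socle `0 :_M J`. -/
def socle (S : Type) [CommRing S] (J : Ideal S) (M : Type) [AddCommGroup M] [Module S M] :
    Submodule S M :=
  ⨅ r ∈ J, LinearMap.ker (LinearMap.lsmul S M r)

/-- Limit closure of the sequence `x` on `M`. -/
def limClo (S : Type) [CommRing S] {v : ℕ} (x : Fin v → S) (M : Type) [AddCommGroup M]
    [Module S M] : Submodule S M :=
  ⨆ t : ℕ, (Ideal.span (Set.range fun i => x i ^ (t + 1)) • (⊤ : Submodule S M)).comap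
      (LinearMap.lsmul S M ((∏ i, x i) ^ t))

end

/-- Krull dimension of a ring, valued in `WithBot ℕ∞`. -/
noncomputable def rdim (S : Type) [CommRing S] : WithBot ℕ∞ :=
  Order.krullDim (PrimeSpectrum S)

namespace TorsExt

section Basic

open Abelian

variable {A : Type} [CommRing A] (J : Ideal A)

/-- `Ext^i(A/J^n, M)`. -/
abbrev extPow (n i : ℕ) (M : Type) [AddCommGroup M] [Module A M] : Type :=
  Ext (ModuleCat.of A (A ⧸ J ^ n)) (ModuleCat.of A M) i

/-- The projection `A/J^k → A/J^n` for `n ≤ k`. -/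
noncomputable def quotPow (n k : ℕ) (h : n ≤ k) :
    ModuleCat.of A (A ⧸ J ^ k) ⟶ ModuleCat.of A (A ⧸ J ^ n) :=
  ModuleCat.ofHom (Submodule.mapQ _ _ LinearMap.id (Ideal.pow_le_pow_right h))

/-- The transition map of the system `Ext^i(A/J^n, M)`. -/
noncomputable def extTrans (i : ℕ) (M : Type) [AddCommGroup M] [Module A M] (n k : ℕ) (h : n ≤ k) :
    extPow J n i M →ₗ[A] extPow J k i M :=
  Ext.precompOfLinear (Ext.mk₀ (quotPow J n k h)) A (ModuleCat.of A M) (zero_add i)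

/-- Local cohomology as the direct limit of the modules `Ext^i(A/J^n, M)`. -/
def LCoh (i : ℕ) (M : Type) [AddCommGroup M] [Module A M] : Type :=
  Module.DirectLimit (fun n => extPow J n i M) (extTrans J i M)

noncomputable instance (i : ℕ) (M : Type) [AddCommGroup M] [Module A M] :
    AddCommGroup (LCoh J i M) :=
  inferInstanceAs (AddCommGroup (Module.DirectLimit (fun n => extPow J n i M) (extTrans J i M)))

noncomputable instance (i : ℕ) (M : Type) [AddCommGroup M] [Module A M] :
    Module A (LCoh J i M) :=
  inferInstanceAs (Module A (Module.DirectLimit (fun n => extPow J n i M) (extTrans J i M)))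

variable {M N P : Type} [AddCommGroup M] [Module A M] [AddCommGroup N] [Module A N]
  [AddCommGroup P] [Module A P]

/-- The canonical map into local cohomology. -/
noncomputable def ofExt (n i : ℕ) (M : Type) [AddCommGroup M] [Module A M] :
    extPow J n i M →ₗ[A] LCoh J i M :=
  Module.DirectLimit.of A ℕ (fun n => extPow J n i M) (extTrans J i M) n

lemma quotPow_self (n : ℕ) : quotPow J n n le_rfl = 𝟙 _ := by
  refine ModuleCat.hom_ext (LinearMap.ext fun x => ?_)
  obtain ⟨x, rfl⟩ := Submodule.Quotient.mk_surjective _ x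
  rfl

lemma quotPow_comp (n k l : ℕ) (h : n ≤ k) (h' : k ≤ l) :
    quotPow J k l h' ≫ quotPow J n k h = quotPow J n l (h.trans h') := by
  refine ModuleCat.hom_ext (LinearMap.ext fun x => ?_)
  obtain ⟨x, rfl⟩ := Submodule.Quotient.mk_surjective _ x
  rfl

lemma extTrans_apply (i n k : ℕ) (h : n ≤ k) (a : extPow J n i M) :
    extTrans J i M n k h a = (Ext.mk₀ (quotPow J n k h)).comp a (zero_add i) := rfl

instance (i : ℕ) :
    DirectedSystem (fun n => extPow J n i M) (fun n k h => extTrans J i M n k h) where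
  map_self n x := by
    rw [extTrans_apply, quotPow_self, Ext.mk₀_id_comp]
  map_map n k l h h' x := by
    simp only [extTrans_apply]
    rw [Ext.mk₀_comp_mk₀_assoc, quotPow_comp]

lemma ofExt_trans (i n k : ℕ) (h : n ≤ k) (a : extPow J n i M) :
    ofExt J k i M (extTrans J i M n k h a) = ofExt J n i M a :=
  Module.DirectLimit.of_f (f := extTrans J i M)

lemma exists_ofExt {i : ℕ} (z : LCoh J i M) : ∃ n a, ofExt J n i M a = z :=
  Module.DirectLimit.exists_of z

lemma ofExt_eq_zero {n i : ℕ} {a : extPow J n i M} (h : ofExt J n i M a = 0) :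
    ∃ (k : ℕ) (hk : n ≤ k), extTrans J i M n k hk a = 0 :=
  Module.DirectLimit.of.zero_exact h

/-- Functoriality of local cohomology. -/
noncomputable def LCoh.map (i : ℕ) (f : M →ₗ[A] N) : LCoh J i M →ₗ[A] LCoh J i N :=
  Module.DirectLimit.map
    (fun n => Ext.postcompOfLinear (Ext.mk₀ (ModuleCat.ofHom f)) A _ (add_zero i))
    (fun n k h => by
      ext a
      simp [extTrans_apply])

lemma map_ofExt (n i : ℕ) (f : M →ₗ[A] N) (a : extPow J n i M) :
    LCoh.map J i f (ofExt J n i M a) =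
      ofExt J n i N (a.comp (Ext.mk₀ (ModuleCat.ofHom f)) (add_zero i)) :=
  Module.DirectLimit.map_apply_of _ _ _

lemma LCoh.map_id (i : ℕ) : LCoh.map J i (LinearMap.id : M →ₗ[A] M) = LinearMap.id := by
  ext z
  obtain ⟨n, a, rfl⟩ := exists_ofExt J z
  rw [map_ofExt]
  exact congrArg _ (Ext.comp_mk₀_id a)

lemma LCoh.map_comp (i : ℕ) (g : N →ₗ[A] P) (f : M →ₗ[A] N) :
    LCoh.map J i (g ∘ₗ f) = LCoh.map J i g ∘ₗ LCoh.map J i f := by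
  ext z
  obtain ⟨n, a, rfl⟩ := exists_ofExt J z
  rw [LinearMap.comp_apply, map_ofExt, map_ofExt, map_ofExt, ModuleCat.ofHom_comp,
    ← Ext.mk₀_comp_mk₀,
    ← Ext.comp_assoc_of_third_deg_zero]

lemma LCoh.map_add (i : ℕ) (f g : M →ₗ[A] N) :
    LCoh.map J i (f + g) = LCoh.map J i f + LCoh.map J i g := by
  ext z
  obtain ⟨n, a, rfl⟩ := exists_ofExt J z
  rw [LinearMap.add_apply, map_ofExt, map_ofExt, map_ofExt, ModuleCat.ofHom_add, Ext.mk₀_add,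
    Ext.comp_add, _root_.map_add]

lemma LCoh.map_smul (i : ℕ) (r : A) (f : M →ₗ[A] N) :
    LCoh.map J i (r • f) = r • LCoh.map J i f := by
  ext z
  obtain ⟨n, a, rfl⟩ := exists_ofExt J z
  rw [LinearMap.smul_apply, map_ofExt, map_ofExt, 
    show ModuleCat.ofHom (r • f) = r • ModuleCat.ofHom f by rfl, Ext.mk₀_smul, Ext.comp_smul,
    _root_.map_smul]

/-- A short exact sequence of modules. -/
structure SES (f : M →ₗ[A] N) (g : N →ₗ[A] P) : Prop where
  inj : Function.Injective f
  exact : Function.Exact f g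
  surj : Function.Surjective g

/-- The associated short complex. -/
noncomputable abbrev SES.sc {f : M →ₗ[A] N} {g : N →ₗ[A] P} (h : SES f g) :
    ShortComplex (ModuleCat.{0} A) :=
  ShortComplex.mk (ModuleCat.ofHom f) (ModuleCat.ofHom g) (by
    ext x
    exact h.exact.apply_apply_eq_zero x)

lemma SES.shortExact {f : M →ₗ[A] N} {g : N →ₗ[A] P} (h : SES f g) : h.sc.ShortExact :=
  ModuleCat.shortComplex_shortExact _ h.exact h.inj h.surj

/-- The connecting homomorphism. -/
noncomputable def LCoh.δ {f : M →ₗ[A] N} {g : N →ₗ[A] P} (h : SES f g) (i : ℕ) :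
    LCoh J i P →ₗ[A] LCoh J (i + 1) M :=
  Module.DirectLimit.map
    (fun n => Ext.postcompOfLinear h.shortExact.extClass A _ rfl)
    (fun n k hk => by
      ext a
      simp only [LinearMap.comp_apply, extTrans_apply]
      exact Ext.comp_assoc _ _ _ (zero_add i) rfl (by lia))

lemma δ_ofExt {f : M →ₗ[A] N} {g : N →ₗ[A] P} (h : SES f g) (n i : ℕ) (a : extPow J n i P) :
    LCoh.δ J h i (ofExt J n i P a) = ofExt J n (i + 1) M (a.comp h.shortExact.extClass rfl) :=
  Module.DirectLimit.map_apply_of _ _ _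

lemma LCoh.exact_map {f : M →ₗ[A] N} {g : N →ₗ[A] P} (h : SES f g) (i : ℕ) :
    Function.Exact (LCoh.map J i f) (LCoh.map J i g) := by
  intro z
  constructor
  · intro hz
    obtain ⟨n, a, rfl⟩ := exists_ofExt J z
    rw [map_ofExt] at hz
    obtain ⟨k, hk, h0⟩ := ofExt_eq_zero J hz
    rw [extTrans_apply, ← Ext.comp_assoc_of_third_deg_zero] at h0
    obtain ⟨b, hb⟩ := Ext.covariant_sequence_exact₂ _ h.shortExact _ h0
    refine ⟨ofExt J k i M b, ?_⟩
    rw [map_ofExt, ← ofExt_trans J i n k hk, extTrans_apply]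
    exact congrArg _ hb
  · rintro ⟨w, rfl⟩
    rw [← LinearMap.comp_apply, ← LCoh.map_comp, h.exact.linearMap_comp_eq_zero]
    have := LCoh.map_smul J i (0 : A) (0 : M →ₗ[A] P)
    rw [zero_smul, zero_smul] at this
    rw [this]; rfl

lemma LCoh.exact_δ {f : M →ₗ[A] N} {g : N →ₗ[A] P} (h : SES f g) (i : ℕ) :
    Function.Exact (LCoh.map J i g) (LCoh.δ J h i) := by
  intro z
  constructor
  · intro hz
    obtain ⟨n, a, rfl⟩ := exists_ofExt J z
    rw [δ_ofExt] at hz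
    obtain ⟨k, hk, h0⟩ := ofExt_eq_zero J hz
    rw [extTrans_apply, ← Ext.comp_assoc (a₁₂ := i) _ _ _ (zero_add i) rfl (by lia)] at h0
    obtain ⟨b, hb⟩ := Ext.covariant_sequence_exact₃ _ h.shortExact _ _ h0
    refine ⟨ofExt J k i N b, ?_⟩
    rw [map_ofExt, ← ofExt_trans J i n k hk, extTrans_apply]
    exact congrArg _ hb
  · rintro ⟨w, rfl⟩
    obtain ⟨n, a, rfl⟩ := exists_ofExt J w
    rw [map_ofExt, δ_ofExt]
    have := h.shortExact.comp_extClass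
    rw [Ext.comp_assoc (a₂₃ := 1) _ _ _ (add_zero i) (zero_add 1) (by lia), this,
      Ext.comp_zero, map_zero]

lemma LCoh.δ_exact {f : M →ₗ[A] N} {g : N →ₗ[A] P} (h : SES f g) (i : ℕ) :
    Function.Exact (LCoh.δ J h i) (LCoh.map J (i + 1) f) := by
  intro z
  constructor
  · intro hz
    obtain ⟨n, a, rfl⟩ := exists_ofExt J z
    rw [map_ofExt] at hz
    obtain ⟨k, hk, h0⟩ := ofExt_eq_zero J hz
    rw [extTrans_apply, ← Ext.comp_assoc_of_third_deg_zero] at h0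
    obtain ⟨b, hb⟩ := Ext.covariant_sequence_exact₁ _ h.shortExact _ h0 rfl
    refine ⟨ofExt J k i P b, ?_⟩
    rw [δ_ofExt, ← ofExt_trans J (i + 1) n k hk, extTrans_apply]
    exact congrArg _ hb
  · rintro ⟨w, rfl⟩
    obtain ⟨n, a, rfl⟩ := exists_ofExt J w
    rw [δ_ofExt, map_ofExt]
    have := h.shortExact.extClass_comp
    rw [Ext.comp_assoc (a₂₃ := 1) _ _ _ rfl (add_zero 1) (by lia), this, Ext.comp_zero, map_zero]

variable {M' N' P' : Type} [AddCommGroup M'] [Module A M'] [AddCommGroup N'] [Module A N']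
  [AddCommGroup P'] [Module A P']

lemma LCoh.δ_naturality {f : M →ₗ[A] N} {g : N →ₗ[A] P} (h : SES f g)
    {f' : M' →ₗ[A] N'} {g' : N' →ₗ[A] P'} (h' : SES f' g')
    (a : M →ₗ[A] M') (b : N →ₗ[A] N') (c : P →ₗ[A] P')
    (hab : b ∘ₗ f = f' ∘ₗ a) (hbc : c ∘ₗ g = g' ∘ₗ b) (i : ℕ) (z : LCoh J i P) :
    LCoh.map J (i + 1) a (LCoh.δ J h i z) = LCoh.δ J h' i (LCoh.map J i c z) := by
  obtain ⟨n, e, rfl⟩ := exists_ofExt J z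
  rw [δ_ofExt, map_ofExt, map_ofExt, δ_ofExt]
  have := ShortComplex.ShortExact.extClass_naturality h.shortExact h'.shortExact
    { τ₁ := ModuleCat.ofHom a
      τ₂ := ModuleCat.ofHom b
      τ₃ := ModuleCat.ofHom c
      comm₁₂ := by
        ext x; exact (LinearMap.congr_fun hab x).symm
      comm₂₃ := by
        ext x; exact (LinearMap.congr_fun hbc x).symm }
  dsimp at this
  rw [Ext.comp_assoc (a₂₃ := 1) _ _ _ rfl (add_zero 1) (by lia),
    Ext.comp_assoc (a₂₃ := 1) _ _ _ (add_zero i) (zero_add 1) (by lia), this]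

/-- Local cohomology vanishes on injective modules in positive degrees. -/
lemma LCoh.eq_zero_of_injective [Module.Injective A M] (i : ℕ) (z : LCoh J (i + 1) M) : z = 0 := by
  obtain ⟨n, e, rfl⟩ := exists_ofExt J z
  have : CategoryTheory.Injective (ModuleCat.of A M) :=
    (Module.injective_iff_injective_object A M).mp inferInstance
  rw [Ext.eq_zero_of_injective e, map_zero]

/-- The submodule of elements killed by a power of `J`. -/
def tors (M : Type) [AddCommGroup M] [Module A M] : Submodule A M where
  carrier := {m | ∃ n : ℕ, ∀ r ∈ J ^ n, r • m = 0}
  zero_mem' := ⟨0, by simp⟩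
  add_mem' := by
    rintro a b ⟨n, hn⟩ ⟨k, hk⟩
    refine ⟨n + k, fun r hr => ?_⟩
    rw [smul_add, hn r (Ideal.pow_le_pow_right (by lia) hr),
      hk r (Ideal.pow_le_pow_right (by lia) hr), add_zero]
  smul_mem' := by
    rintro c a ⟨n, hn⟩
    exact ⟨n, fun r hr => by rw [smul_comm, hn r hr, smul_zero]⟩

lemma mem_tors {m : M} : m ∈ tors J M ↔ ∃ n : ℕ, ∀ r ∈ J ^ n, r • m = 0 := Iff.rfl

lemma extPow_smul_eq_zero {n i : ℕ} {r : A} (hr : r ∈ J ^ n) (e : extPow J n i M) :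
    r • e = 0 := by
  have : r • e = (Ext.mk₀ (r • 𝟙 (ModuleCat.of A (A ⧸ J ^ n)))).comp e (zero_add i) := by
    rw [Ext.mk₀_smul, Ext.smul_comp, Ext.mk₀_id_comp]
  have h0 : r • 𝟙 (ModuleCat.of A (A ⧸ J ^ n)) = 0 := by
    refine ModuleCat.hom_ext (LinearMap.ext fun x => ?_)
    obtain ⟨x, rfl⟩ := Submodule.Quotient.mk_surjective _ x
    change r • (Submodule.Quotient.mk x : A ⧸ J ^ n) = 0
    rw [← Submodule.Quotient.mk_smul, Submodule.Quotient.mk_eq_zero]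
    exact Ideal.mul_mem_right _ _ hr
  rw [this, h0, Ext.mk₀_zero, Ext.zero_comp]

lemma tors_LCoh (i : ℕ) (z : LCoh J i M) : z ∈ tors J (LCoh J i M) := by
  obtain ⟨n, e, rfl⟩ := exists_ofExt J z
  exact ⟨n, fun r hr => by rw [← map_smul, extPow_smul_eq_zero J hr, map_zero]⟩

end Basic

section DegreeZero

open Abelian

variable {A : Type} [CommRing A] (J : Ideal A)
variable {M N P : Type} [AddCommGroup M] [Module A M] [AddCommGroup N] [Module A N]
  [AddCommGroup P] [Module A P]

/-- Evaluation at `1` of an element of `Ext^0(A/J^n, M)`. -/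
noncomputable def evalOneAt (n : ℕ) (M : Type) [AddCommGroup M] [Module A M] :
    extPow J n 0 M →ₗ[A] M where
  toFun e := (Ext.linearEquiv₀ (R := A) e).hom (Submodule.Quotient.mk 1)
  map_add' a b := by rw [map_add]; rfl
  map_smul' r a := by rw [map_smul]; rfl

lemma evalOneAt_mk₀ (n : ℕ) (f : (A ⧸ J ^ n) →ₗ[A] M) :
    evalOneAt J n M (Ext.mk₀ (ModuleCat.ofHom f)) = f (Submodule.Quotient.mk 1) := by
  have : Ext.linearEquiv₀ (R := A) (Ext.mk₀ (ModuleCat.ofHom f)) = ModuleCat.ofHom f :=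
    (Ext.linearEquiv₀ (R := A)).apply_symm_apply (ModuleCat.ofHom f)
  change (Ext.linearEquiv₀ (R := A) (Ext.mk₀ (ModuleCat.ofHom f))).hom _ = _
  rw [this]; rfl

lemma exists_mk₀ {n : ℕ} (e : extPow J n 0 M) :
    ∃ f : (A ⧸ J ^ n) →ₗ[A] M, Ext.mk₀ (ModuleCat.ofHom f) = e :=
  ⟨(Ext.linearEquiv₀ (R := A) e).hom, Ext.mk₀_linearEquiv₀_apply (R := A) e⟩

/-- Evaluation at `1` on local cohomology in degree zero. -/
noncomputable def evalOne (M : Type) [AddCommGroup M] [Module A M] : LCoh J 0 M →ₗ[A] M :=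
  Module.DirectLimit.lift _ _ _ _ (fun n => evalOneAt J n M) (by
    intro n k h e
    obtain ⟨f, rfl⟩ := exists_mk₀ J e
    rw [extTrans_apply, Ext.mk₀_comp_mk₀, evalOneAt_mk₀, quotPow, ← ModuleCat.ofHom_comp,
      evalOneAt_mk₀]
    rfl)

lemma evalOne_ofExt {n : ℕ} (f : (A ⧸ J ^ n) →ₗ[A] M) :
    evalOne J M (ofExt J n 0 M (Ext.mk₀ (ModuleCat.ofHom f))) = f (Submodule.Quotient.mk 1) :=
  (Module.DirectLimit.lift_of _ _ _).trans (evalOneAt_mk₀ J n f)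

lemma evalOne_injective : Function.Injective (evalOne J M) := by
  rw [injective_iff_map_eq_zero]
  intro z hz
  obtain ⟨n, e, rfl⟩ := exists_ofExt J z
  obtain ⟨f, rfl⟩ := exists_mk₀ J e
  rw [evalOne_ofExt] at hz
  have : f = 0 := by
    ext
    exact hz
  rw [this, ModuleCat.ofHom_zero, Ext.mk₀_zero, map_zero]

lemma range_evalOne : LinearMap.range (evalOne J M) = tors J M := by
  ext m
  constructor
  · rintro ⟨z, rfl⟩
    obtain ⟨n, hn⟩ := tors_LCoh J 0 z
    exact ⟨n, fun r hr => by rw [← map_smul, hn r hr, map_zero]⟩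
  · rintro ⟨n, hn⟩
    refine ⟨ofExt J n 0 M (Ext.mk₀ (ModuleCat.ofHom
      ((J ^ n).liftQ (LinearMap.toSpanSingleton A M m) fun r hr => hn r hr))), ?_⟩
    rw [evalOne_ofExt]
    exact one_smul A m

lemma evalOne_map (f : M →ₗ[A] N) (z : LCoh J 0 M) :
    evalOne J N (LCoh.map J 0 f z) = f (evalOne J M z) := by
  obtain ⟨n, e, rfl⟩ := exists_ofExt J z
  obtain ⟨g, rfl⟩ := exists_mk₀ J e
  rw [map_ofExt, Ext.mk₀_comp_mk₀, ← ModuleCat.ofHom_comp, evalOne_ofExt, evalOne_ofExt]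
  rfl

lemma LCoh.map_zero (i : ℕ) : LCoh.map J i (0 : M →ₗ[A] N) = 0 := by
  have := LCoh.map_smul J i (0 : A) (0 : M →ₗ[A] N)
  rwa [zero_smul, zero_smul] at this

lemma LCoh.map_lsmul (i : ℕ) (r : A) (z : LCoh J i M) :
    LCoh.map J i (LinearMap.lsmul A M r) z = r • z := by
  have : LinearMap.lsmul A M r = r • LinearMap.id := rfl
  rw [this, LCoh.map_smul, LCoh.map_id]; rfl

/-- Local cohomology is invariant under linear equivalences. -/
noncomputable def LCoh.congr (i : ℕ) (e : M ≃ₗ[A] N) : LCoh J i M ≃ₗ[A] LCoh J i N :=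
  LinearEquiv.ofLinearMap (LCoh.map J i e) (LCoh.map J i e.symm)
    (by rw [← LCoh.map_comp, e.comp_symm, LCoh.map_id])
    (by rw [← LCoh.map_comp, e.symm_comp, LCoh.map_id])

end DegreeZero

section Comparison

open Abelian Opposite

variable {A : Type} [CommRing A] {X : ModuleCat.{0} A} (P : ProjectiveResolution X)
  (Y : ModuleCat.{0} A)

lemma extMk_eq_zero_degree_zero {f : P.complex.X 0 ⟶ Y} (hf : P.complex.d 1 0 ≫ f = 0)
    (h : P.extMk f 1 rfl hf = 0) : f = 0 := by
  rw [← P.extEquivCohomologyClass.apply_eq_iff_eq,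
    ProjectiveResolution.extEquivCohomologyClass_extMk,
    ProjectiveResolution.extEquivCohomologyClass_zero,
    CochainComplex.HomComplex.CohomologyClass.mk_eq_zero_iff,
    CochainComplex.HomComplex.Cocycle.toSingleMk_mem_coboundaries_iff _ _ _ _ _ 1 (by lia)] at h
  obtain ⟨g, hg⟩ := h
  have hz : Limits.IsZero (P.cochainComplex.X 1) :=
    P.cochainComplex.isZero_of_isStrictlyLE 0 1 (by lia)
  rw [hz.eq_of_src g 0, Limits.comp_zero] at hg
  have := (cancel_epi (P.cochainComplexXIso (-0) 0 rfl).hom).mp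
    (hg.symm.trans Limits.comp_zero.symm)
  exact this

/-- The complex computing the derived functors of `Hom(-, Y)` in the opposite category. -/
noncomputable abbrev homCpx : ChainComplex (ModuleCat.{0} A)ᵒᵖ ℕ :=
  (((linearYoneda A (ModuleCat.{0} A)).obj Y).rightOp.mapHomologicalComplex _).obj P.complex

/-- Cocycles. -/
noncomputable abbrev cocyc (n : ℕ) : ModuleCat.{0} A := ((homCpx P Y).opcycles n).unop

/-- Inclusion of cocycles in cochains. -/
noncomputable def cocycIncl (n : ℕ) : cocyc P Y n →ₗ[A] (P.complex.X n ⟶ Y) :=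
  ((homCpx P Y).pOpcycles n).unop.hom

lemma cocycIncl_injective (n : ℕ) : Function.Injective (cocycIncl P Y n) := by
  have : Mono ((homCpx P Y).pOpcycles n).unop := inferInstance
  exact (ModuleCat.mono_iff_injective _).mp this

lemma d_cocycIncl (n : ℕ) (c : cocyc P Y n) :
    P.complex.d (n + 1) n ≫ cocycIncl P Y n c = 0 := by
  have := (homCpx P Y).d_pOpcycles (n + 1) n
  have := congrArg (fun f => f.unop.hom c) this
  exact this

lemma exists_cocyc (n : ℕ) (f : P.complex.X n ⟶ Y) (hf : P.complex.d (n + 1) n ≫ f = 0) :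
    ∃ c, cocycIncl P Y n c = f := by
  let φ : (homCpx P Y).X n ⟶ op (ModuleCat.of A A) :=
    (ModuleCat.ofHom (LinearMap.toSpanSingleton A (P.complex.X n ⟶ Y) f)).op
  have hφ : (homCpx P Y).d (n + 1) n ≫ φ = 0 := by
    apply Quiver.Hom.unop_inj
    refine ModuleCat.hom_ext (LinearMap.ext fun r => ?_)
    change P.complex.d (n + 1) n ≫ (r • f) = 0
    rw [Linear.comp_smul, hf, smul_zero]
  refine ⟨((homCpx P Y).descOpcycles φ (n + 1) (by simp) hφ).unop.hom 1, ?_⟩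
  have := (homCpx P Y).p_descOpcycles φ (n + 1) (by simp) hφ
  have := congrArg (fun f => f.unop.hom (1 : A)) this
  exact this.trans (one_smul A f)

/-- The projection from cocycles to derived functors. -/
noncomputable def cocycProj (n : ℕ) :
    cocyc P Y n →ₗ[A] ((((_root_.Ext A (ModuleCat.{0} A) n).obj (op X)).obj Y : ModuleCat.{0} A)) :=
  ((P.isoLeftDerivedObj ((linearYoneda A (ModuleCat.{0} A)).obj Y).rightOp n).hom ≫
    (homCpx P Y).homologyι n).unop.hom

lemma cocycProj_surjective (n : ℕ) : Function.Surjective (cocycProj P Y n) := by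
  have h1 : Epi ((homCpx P Y).homologyι n).unop := inferInstance
  have h2 : Epi (P.isoLeftDerivedObj
    ((linearYoneda A (ModuleCat.{0} A)).obj Y).rightOp n).hom.unop := inferInstance
  exact ((ModuleCat.epi_iff_surjective _).mp h2).comp ((ModuleCat.epi_iff_surjective _).mp h1)

/-- The class of a cocycle in `Ext`. -/
noncomputable def cocycExt (n : ℕ) : cocyc P Y n →ₗ[A] Abelian.Ext X Y n where
  toFun c := P.extMk (cocycIncl P Y n c) (n + 1) rfl (d_cocycIncl P Y n c)
  map_add' a b := by
    rw [ProjectiveResolution.add_extMk]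
    congr 1
    exact map_add _ _ _
  map_smul' r a := by
    rw [RingHom.id_apply, Abelian.Ext.smul_eq_comp_mk₀, ProjectiveResolution.extMk_comp_mk₀]
    congr 1
    rw [map_smul, Linear.comp_smul, Category.comp_id]

lemma cocycExt_surjective (n : ℕ) : Function.Surjective (cocycExt P Y n) := by
  intro e
  obtain ⟨f, hf, rfl⟩ := P.extMk_surjective e (n + 1) rfl
  obtain ⟨c, rfl⟩ := exists_cocyc P Y n f hf
  exact ⟨c, rfl⟩

lemma cocycProj_eq_zero_iff (n : ℕ) (c : cocyc P Y n) :
    cocycProj P Y n c = 0 ↔ cocycExt P Y n c = 0 := by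
  have h1 : cocycProj P Y n c = 0 ↔ ((homCpx P Y).homologyι n).unop.hom c = 0 := by
    have : Mono (P.isoLeftDerivedObj
        ((linearYoneda A (ModuleCat.{0} A)).obj Y).rightOp n).hom.unop := inferInstance
    exact map_eq_zero_iff _ ((ModuleCat.mono_iff_injective _).mp this)
  rw [h1]
  cases n with
  | zero =>
    have : Mono ((homCpx P Y).homologyι 0).unop := inferInstance
    rw [map_eq_zero_iff _ ((ModuleCat.mono_iff_injective _).mp this)]
    constructor
    · rintro rfl; exact map_zero _
    · intro h
      have := extMk_eq_zero_degree_zero P Y (d_cocycIncl P Y 0 c) h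
      exact (map_eq_zero_iff _ (cocycIncl_injective P Y 0)).mp this
  | succ n =>
    have hk := (homCpx P Y).homologyIsKernel (n + 1) n (by simp)
    have hex := ShortComplex.exact_of_f_is_kernel
      (ShortComplex.mk ((homCpx P Y).homologyι (n + 1)) ((homCpx P Y).fromOpcycles (n + 1) n)
        (by simp)) hk
    have hex' := (ShortComplex.moduleCat_exact_iff _).mp hex.unop
    have hp := (homCpx P Y).p_fromOpcycles (n + 1) n
    have hp' (g : P.complex.X n ⟶ Y) : cocycIncl P Y (n + 1)
        (((homCpx P Y).fromOpcycles (n + 1) n).unop.hom g) = P.complex.d (n + 1) n ≫ g :=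
      congrArg (fun f => f.unop.hom g) hp
    have h2 : cocycExt P Y (n + 1) c = 0 ↔ _ :=
      P.extMk_eq_zero_iff (cocycIncl P Y (n + 1) c) (n + 1 + 1) rfl (d_cocycIncl P Y (n + 1) c)
        n rfl
    rw [h2]
    constructor
    · intro h
      obtain ⟨g, hg⟩ := hex' c h
      exact ⟨g, by rw [← hp' g]; exact congrArg _ hg⟩
    · rintro ⟨g, hg⟩
      rw [← hp' g] at hg
      have := cocycIncl_injective P Y (n + 1) hg
      rw [← this]
      have := ((homCpx P Y).homologyι_comp_fromOpcycles (n + 1) n)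
      exact congrArg (fun f => f.unop.hom g) this

/-- Two quotient maps with the same kernel have isomorphic targets. -/
noncomputable def equivOfKer {C D E : Type} [AddCommGroup C] [AddCommGroup D] [AddCommGroup E]
    [Module A C] [Module A D] [Module A E] (f : C →ₗ[A] D) (g : C →ₗ[A] E)
    (hf : Function.Surjective f) (hg : Function.Surjective g) (h : ∀ c, f c = 0 ↔ g c = 0) :
    D ≃ₗ[A] E :=
  (f.quotKerEquivOfSurjective hf).symm ≪≫ₗ
    Submodule.quotEquivOfEq _ _ (by ext c; exact h c) ≪≫ₗ g.quotKerEquivOfSurjective hg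

lemma equivOfKer_apply {C D E : Type} [AddCommGroup C] [AddCommGroup D] [AddCommGroup E]
    [Module A C] [Module A D] [Module A E] (f : C →ₗ[A] D) (g : C →ₗ[A] E)
    (hf : Function.Surjective f) (hg : Function.Surjective g) (h : ∀ c, f c = 0 ↔ g c = 0)
    (c : C) : equivOfKer f g hf hg h (f c) = g c := by
  have : (f.quotKerEquivOfSurjective hf).symm (f c) = Submodule.Quotient.mk c := by
    rw [LinearEquiv.symm_apply_eq]; rfl
  simp only [equivOfKer, LinearEquiv.trans_apply, this]
  rfl

/-- The two versions of `Ext` agree. -/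
noncomputable def extEquiv (n : ℕ) :
    ((((_root_.Ext A (ModuleCat.{0} A) n).obj (op X)).obj Y : ModuleCat.{0} A)) ≃ₗ[A]
      Abelian.Ext X Y n :=
  equivOfKer (cocycProj P Y n) (cocycExt P Y n) (cocycProj_surjective P Y n)
    (cocycExt_surjective P Y n) (cocycProj_eq_zero_iff P Y n)

lemma extEquiv_apply (n : ℕ) (c : cocyc P Y n) :
    extEquiv P Y n (cocycProj P Y n c) = cocycExt P Y n c :=
  equivOfKer_apply _ _ _ _ _ _

lemma extEquiv_naturality {X' : ModuleCat.{0} A} (P' : ProjectiveResolution X') (g : X' ⟶ X)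
    (n : ℕ) (z : (((_root_.Ext A (ModuleCat.{0} A) n).obj (op X)).obj Y : ModuleCat.{0} A)) :
    extEquiv P' Y n ((((_root_.Ext A (ModuleCat.{0} A) n).map g.op).app Y).hom z) =
      (Abelian.Ext.mk₀ g).comp (extEquiv P Y n z) (zero_add n) := by
  obtain ⟨c, rfl⟩ := cocycProj_surjective P Y n z
  let φ : ProjectiveResolution.Hom P' P g :=
    { hom := ProjectiveResolution.lift g P' P
      hom_f_zero_comp_π_f_zero := by
        have := ProjectiveResolution.lift_commutes g P' P
        rw [← HomologicalComplex.comp_f, this, HomologicalComplex.comp_f] }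
  let Φ : homCpx P' Y ⟶ homCpx P Y :=
    (((linearYoneda A (ModuleCat.{0} A)).obj Y).rightOp.mapHomologicalComplex _).map φ.hom
  let c' : cocyc P' Y n := (HomologicalComplex.opcyclesMap Φ n).unop.hom c
  have h1 : cocycIncl P' Y n c' = φ.hom.f n ≫ cocycIncl P Y n c := by
    have := HomologicalComplex.p_opcyclesMap Φ n
    exact congrArg (fun f => f.unop.hom c) this
  have h2 : ((((_root_.Ext A (ModuleCat.{0} A) n).map g.op).app Y).hom (cocycProj P Y n c)) =
      cocycProj P' Y n c' := by
    have e1 := ProjectiveResolution.isoLeftDerivedObj_hom_naturality g P' P φ.hom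
      (by rw [φ.hom_f_zero_comp_π_f_zero]; simp)
      ((linearYoneda A (ModuleCat.{0} A)).obj Y).rightOp n
    have e2 := HomologicalComplex.homologyι_naturality Φ n
    have e1' := congrArg (fun f => f.unop.hom (((homCpx P Y).homologyι n).unop.hom c)) e1
    have e2' := congrArg (fun f => (P'.isoLeftDerivedObj
      ((linearYoneda A (ModuleCat.{0} A)).obj Y).rightOp n).hom.unop.hom (f.unop.hom c)) e2
    exact e1'.trans e2'
  rw [h2, extEquiv_apply, extEquiv_apply]
  refine Eq.trans ?_ (ProjectiveResolution.mk₀_comp_extMk (cocycIncl P Y n c) (n + 1) rfl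
    (d_cocycIncl P Y n c) φ).symm
  change P'.extMk (cocycIncl P' Y n c') (n + 1) rfl (d_cocycIncl P' Y n c') = _
  congr 1

end Comparison

section Colimit

open Opposite Limits

variable {A : Type} [CommRing A] (J : Ideal A) (i : ℕ) (M : ModuleCat.{0} A)

/-- The diagram computing local cohomology of `M`. -/
noncomputable abbrev lcDiag : ℕᵒᵖᵒᵖ ⥤ ModuleCat.{0} A :=
  localCohomology.diagram (localCohomology.idealPowersDiagram J) i ⋙
    (evaluation (ModuleCat.{0} A) (ModuleCat.{0} A)).obj M

/-- The comparison of the terms of `lcDiag` with the new version of `Ext`. -/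
noncomputable def lcTerm (n : ℕ) : (lcDiag J i M).obj (op (op n)) ≃ₗ[A] extPow J n i M :=
  extEquiv (projectiveResolution (ModuleCat.of A (A ⧸ J ^ n))) M i

lemma lcTerm_map (n k : ℕ) (h : n ≤ k) (z : (lcDiag J i M).obj (op (op n))) :
    lcTerm J i M k (((lcDiag J i M).map (homOfLE h).op.op).hom z) =
      extTrans J i M n k h (lcTerm J i M n z) := by
  rw [extTrans_apply]
  exact extEquiv_naturality _ M _ (quotPow J n k h) i z

/-- `LCoh` as a cocone. -/
noncomputable def lcCocone : Cocone (lcDiag J i M) where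
  pt := ModuleCat.of A (LCoh J i M)
  ι :=
    { app := fun j => ModuleCat.ofHom (ofExt J j.unop.unop i M ∘ₗ
        (lcTerm J i M j.unop.unop).toLinearMap)
      naturality := by
        rintro ⟨⟨n⟩⟩ ⟨⟨k⟩⟩ f
        have h : n ≤ k := f.unop.unop.le
        obtain rfl : f = (homOfLE h).op.op := rfl
        refine ModuleCat.hom_ext (LinearMap.ext fun z => ?_)
        have := lcTerm_map J i M n k h z
        have := (congrArg (ofExt J k i M) this).trans (ofExt_trans J i n k h _)
        exact this }

lemma lcDiag_cocone_w (s : Cocone (lcDiag J i M)) (n k : ℕ) (h : n ≤ k)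
    (z : (lcDiag J i M).obj (op (op n))) :
    (s.ι.app (op (op k))).hom (((lcDiag J i M).map (homOfLE h).op.op).hom z) =
      (s.ι.app (op (op n))).hom z :=
  congrArg (fun f => f.hom z) (s.w (homOfLE h).op.op)

/-- The map out of `LCoh` induced by a cocone. -/
noncomputable def lcDesc (s : Cocone (lcDiag J i M)) : LCoh J i M →ₗ[A] s.pt :=
  Module.DirectLimit.lift A ℕ (fun n => extPow J n i M)
    (extTrans J i M)
    (fun n => (s.ι.app (op (op n))).hom ∘ₗ (lcTerm J i M n).symm.toLinearMap) (by
      intro n k h x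
      obtain ⟨z, rfl⟩ := (lcTerm J i M n).surjective x
      rw [← lcTerm_map J i M n k h z]
      simp only [LinearMap.comp_apply, LinearEquiv.coe_coe, LinearEquiv.symm_apply_apply]
      exact lcDiag_cocone_w J i M s n k h z)

lemma lcDesc_of (s : Cocone (lcDiag J i M)) (n : ℕ) (z : (lcDiag J i M).obj (op (op n))) :
    lcDesc J i M s (ofExt J n i M (lcTerm J i M n z)) = (s.ι.app (op (op n))).hom z := by
  refine (Module.DirectLimit.lift_of (f := extTrans J i M) _ _ _).trans ?_
  simp only [LinearMap.comp_apply, LinearEquiv.coe_coe, LinearEquiv.symm_apply_apply]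

/-- `LCoh` is a colimit. -/
noncomputable def lcCoconeIsColimit : IsColimit (lcCocone J i M) where
  desc s := ModuleCat.ofHom (lcDesc J i M s)
  fac s := by
    rintro ⟨⟨n⟩⟩
    exact ModuleCat.hom_ext (LinearMap.ext fun z => lcDesc_of J i M s n z)
  uniq s m hm := by
    refine ModuleCat.hom_ext (LinearMap.ext fun z => ?_)
    obtain ⟨n, a, rfl⟩ := exists_ofExt J z
    obtain ⟨z, rfl⟩ := (lcTerm J i M n).surjective a
    have := congrArg (fun f => f.hom z) (hm (op (op n)))
    exact Eq.trans this (lcDesc_of J i M s n z).symm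

/-- Mathlib's local cohomology is `LCoh`. -/
noncomputable def lcIso : (localCohomology J i).obj M ≅ ModuleCat.of A (LCoh J i M) :=
  (isColimitOfPreserves ((evaluation (ModuleCat.{0} A) (ModuleCat.{0} A)).obj M)
    (colimit.isColimit (localCohomology.diagram (localCohomology.idealPowersDiagram J)
      i))).coconePointUniqueUpToIso (lcCoconeIsColimit J i M)

/-- Mathlib's local cohomology is `LCoh`. -/
noncomputable def lcEquiv : (localCohomology J i).obj M ≃ₗ[A] LCoh J i M :=
  (lcIso J i M).toLinearEquiv

end Colimit

section Torsion

variable {A : Type} [CommRing A] (J : Ideal A)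
variable {M N P : Type} [AddCommGroup M] [Module A M] [AddCommGroup N] [Module A N]
  [AddCommGroup P] [Module A P]

lemma SES.ofInjective {f : M →ₗ[A] N} (hf : Function.Injective f) :
    SES f (LinearMap.range f).mkQ :=
  ⟨hf, LinearMap.exact_map_mkQ_range f, Submodule.mkQ_surjective _⟩

lemma SES.ofSurjective {g : N →ₗ[A] P} (hg : Function.Surjective g) :
    SES (LinearMap.ker g).subtype g :=
  ⟨Subtype.val_injective, LinearMap.exact_subtype_ker_map g, hg⟩

lemma SES.ofSubmodule (U : Submodule A M) : SES U.subtype U.mkQ :=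
  ⟨Subtype.val_injective, LinearMap.exact_subtype_mkQ U, Submodule.mkQ_surjective _⟩

lemma exists_pow_smul_eq_zero {U : Submodule A M} (hU : U.FG) (h : U ≤ tors J M) :
    ∃ n : ℕ, ∀ r ∈ J ^ n, ∀ m ∈ U, r • m = 0 := by
  induction U, hU using Submodule.fg_induction with
  | singleton m =>
    obtain ⟨n, hn⟩ := h (Submodule.mem_span_singleton_self m)
    refine ⟨n, fun r hr y hy => ?_⟩
    obtain ⟨a, rfl⟩ := Submodule.mem_span_singleton.mp hy
    rw [smul_comm, hn r hr, smul_zero]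
  | sup U V _ _ hU hV =>
    obtain ⟨n, hn⟩ := hU (le_sup_left.trans h)
    obtain ⟨k, hk⟩ := hV (le_sup_right.trans h)
    refine ⟨max n k, fun r hr y hy => ?_⟩
    obtain ⟨u, hu, v, hv, rfl⟩ := Submodule.mem_sup.mp hy
    rw [smul_add, hn r (Ideal.pow_le_pow_right (le_max_left _ _) hr) u hu,
      hk r (Ideal.pow_le_pow_right (le_max_right _ _) hr) v hv, add_zero]

/-- The torsion submodule of an injective module over a Noetherian ring is injective. -/
lemma injective_tors [IsNoetherianRing A] [Module.Injective A M] :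
    Module.Injective A (tors J M) := by
  apply Module.Baer.injective
  intro I g
  obtain ⟨n, hn⟩ := exists_pow_smul_eq_zero J (U := LinearMap.range ((tors J M).subtype ∘ₗ g))
    (by rw [LinearMap.range_eq_map]; exact Submodule.FG.map _ (Module.Finite.fg_top))
    (by rintro _ ⟨x, rfl⟩; exact (g x).2)
  obtain ⟨k, hk⟩ := J.exists_pow_inf_eq_pow_smul (M := A) I
  have hle : J ^ (n + k) ⊓ I ≤ J ^ n * I := by
    have := hk (n + k) (by lia)
    rw [Nat.add_sub_cancel, smul_eq_mul, Ideal.mul_top] at this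
    rw [this]
    exact Ideal.mul_mono_right inf_le_right
  have hg (y : I) (hy : (y : A) ∈ J ^ (n + k)) : g y = 0 := by
    have h1 : (y : A) ∈ J ^ n • I := hle ⟨hy, y.2⟩
    have h2 : ∀ z (hz : z ∈ I), z ∈ J ^ n • I → g ⟨z, hz⟩ = 0 := by
      intro z hz h
      refine Submodule.smul_induction_on' (p := fun z _ => ∀ hz : z ∈ I, g ⟨z, hz⟩ = 0) h
        ?_ ?_ hz
      · intro r hr m hm hz
        have : g ⟨r • m, hz⟩ = r • g ⟨m, hm⟩ := by rw [← map_smul]; rfl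
        rw [this]
        exact Subtype.ext (hn r hr _ ⟨⟨m, hm⟩, rfl⟩)
      · intro a ha b hb iha ihb hz
        have hle' : J ^ n • I ≤ I := Submodule.smul_le_right
        have : g ⟨a + b, hz⟩ = g ⟨a, hle' ha⟩ + g ⟨b, hle' hb⟩ := by rw [← map_add]; rfl
        rw [this, iha, ihb, add_zero]
    exact h2 y y.2 h1
  let q : I →ₗ[A] A ⧸ J ^ (n + k) := (J ^ (n + k)).mkQ ∘ₗ I.subtype
  have hq : LinearMap.ker q ≤ LinearMap.ker ((tors J M).subtype ∘ₗ g) := by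
    intro y hy
    have : (y : A) ∈ J ^ (n + k) := (Submodule.Quotient.mk_eq_zero _).mp hy
    rw [LinearMap.mem_ker, LinearMap.comp_apply, hg y this, map_zero]
  obtain ⟨h, hh⟩ := Module.Injective.out ((LinearMap.ker q).liftQ q le_rfl)
    (LinearMap.ker_eq_bot.mp (Submodule.ker_liftQ_eq_bot _ _ _ le_rfl))
    ((LinearMap.ker q).liftQ _ hq)
  refine ⟨(h ∘ₗ (J ^ (n + k)).mkQ).codRestrict (tors J M) fun a => ?_, fun a ha => ?_⟩
  · refine ⟨n + k, fun r hr => ?_⟩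
    rw [LinearMap.comp_apply, ← map_smul, ← map_smul]
    have : (J ^ (n + k)).mkQ (r • a) = 0 :=
      (Submodule.Quotient.mk_eq_zero _).mpr (Ideal.mul_mem_right _ _ hr)
    rw [this, map_zero]
  · exact Subtype.ext (hh (Submodule.Quotient.mk ⟨a, ha⟩))

lemma exists_injective_embedding (M : Type) [AddCommGroup M] [Module A M] :
    ∃ (I : Type) (_ : AddCommGroup I) (_ : Module A I) (f : M →ₗ[A] I),
      Module.Injective A I ∧ Function.Injective f := by
  let E : ModuleCat.{0} A := CategoryTheory.Injective.under (ModuleCat.of A M)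
  let f : ModuleCat.of A M ⟶ E := CategoryTheory.Injective.ι (ModuleCat.of A M)
  refine ⟨E, inferInstance, inferInstance, f.hom,
    ?_, (ModuleCat.mono_iff_injective f).mp
      (inferInstanceAs (Mono (CategoryTheory.Injective.ι (ModuleCat.of A M))))⟩
  exact (Module.injective_iff_injective_object A _).mpr
    (inferInstanceAs (CategoryTheory.Injective E))

lemma exists_torsion_injective_embedding [IsNoetherianRing A] (h : tors J M = ⊤) :
    ∃ (I : Type) (_ : AddCommGroup I) (_ : Module A I) (f : M →ₗ[A] I),
      Module.Injective A I ∧ tors J I = ⊤ ∧ Function.Injective f := by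
  obtain ⟨I, _, _, f, hI, hf⟩ := exists_injective_embedding (A := A) M
  refine ⟨tors J I, inferInstance, inferInstance, f.codRestrict _ fun m => ?_,
    injective_tors J, ?_, fun a b hab => hf (congrArg Subtype.val hab)⟩
  · obtain ⟨n, hn⟩ := h.ge (Submodule.mem_top (x := m))
    exact ⟨n, fun r hr => by rw [← map_smul, hn r hr, map_zero]⟩
  · refine eq_top_iff.mpr fun m _ => ?_
    obtain ⟨n, hn⟩ := m.2
    exact ⟨n, fun r hr => Subtype.ext (hn r hr)⟩

lemma tors_eq_top_of_surjective {g : M →ₗ[A] N} (hg : Function.Surjective g) (h : tors J M = ⊤) :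
    tors J N = ⊤ := by
  refine eq_top_iff.mpr fun m _ => ?_
  obtain ⟨m, rfl⟩ := hg m
  obtain ⟨n, hn⟩ := h.ge (Submodule.mem_top (x := m))
  exact ⟨n, fun r hr => by rw [← map_smul, hn r hr, map_zero]⟩

lemma evalOne_surjective (h : tors J M = ⊤) : Function.Surjective (evalOne J M) := by
  rw [← LinearMap.range_eq_top, range_evalOne, h]

lemma LCoh.map_zero_surjective {g : M →ₗ[A] N} (hg : Function.Surjective g) (h : tors J M = ⊤) :
    Function.Surjective (LCoh.map J 0 g) := by
  intro z
  obtain ⟨m, hm⟩ := hg (evalOne J N z)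
  obtain ⟨y, rfl⟩ := evalOne_surjective J h m
  exact ⟨y, evalOne_injective J (by rw [evalOne_map, hm])⟩

/-- Higher local cohomology of torsion modules vanishes. -/
lemma LCoh.eq_zero_of_tors [IsNoetherianRing A] (h : tors J M = ⊤) (i : ℕ)
    (z : LCoh J (i + 1) M) : z = 0 := by
  induction i generalizing M with
  | zero =>
    obtain ⟨I, _, _, f, hI, hI', hf⟩ := exists_torsion_injective_embedding J h
    have hs := SES.ofInjective hf
    obtain ⟨y, rfl⟩ := (LCoh.δ_exact J hs 0 z).mp (LCoh.eq_zero_of_injective J 0 _)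
    obtain ⟨w, rfl⟩ := LCoh.map_zero_surjective J hs.surj hI' y
    exact (LCoh.exact_δ J hs 0).apply_apply_eq_zero w
  | succ i ih =>
    obtain ⟨I, _, _, f, hI, hI', hf⟩ := exists_torsion_injective_embedding J h
    have hs := SES.ofInjective hf
    obtain ⟨y, rfl⟩ := (LCoh.δ_exact J hs (i + 1) z).mp (LCoh.eq_zero_of_injective J _ _)
    rw [ih (tors_eq_top_of_surjective J hs.surj hI') y, _root_.map_zero]

end Torsion

lemma exists_addEquiv {C D E : Type} [AddCommGroup C] [AddCommGroup D] [AddCommGroup E]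
    (f : C →+ D) (g : C →+ E) (hf : Function.Surjective f) (hg : Function.Surjective g)
    (h : ∀ c, f c = 0 ↔ g c = 0) : ∃ e : D ≃+ E, ∀ c, e (f c) = g c := by
  refine ⟨(equivOfKer f.toIntLinearMap g.toIntLinearMap hf hg h).toAddEquiv, fun c => ?_⟩
  exact equivOfKer_apply f.toIntLinearMap g.toIntLinearMap hf hg h c

section Divisible

variable {R : Type} [CommRing R]

lemma smul_surjective_of_injective {I : Type} [AddCommGroup I] [Module R I] [Module.Injective R I]
    {x : R} (hx : IsSMulRegular R x) : Function.Surjective (LinearMap.lsmul R I x) := by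
  intro e
  obtain ⟨h, hh⟩ := Module.Injective.out (LinearMap.lsmul R R x) hx
    (LinearMap.toSpanSingleton R I e)
  refine ⟨h 1, ?_⟩
  have := hh 1
  have h2 : h (x • 1) = x • h 1 := h.map_smul x 1
  exact h2.symm.trans (this.trans (one_smul R e))

lemma SES.torsionBy {I : Type} [AddCommGroup I] [Module R I] {x : R}
    (h : Function.Surjective (LinearMap.lsmul R I x)) :
    SES (Submodule.torsionBy R I x).subtype (LinearMap.lsmul R I x) :=
  SES.ofSurjective h

lemma LCoh.eq_zero_torsionBy [IsNoetherianRing R] (J : Ideal R) {I : Type} [AddCommGroup I]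
    [Module R I] [Module.Injective R I] {x : R} (hx : IsSMulRegular R x) (i : ℕ)
    (z : LCoh J (i + 1) (Submodule.torsionBy R I x)) : z = 0 := by
  have hs := SES.torsionBy (smul_surjective_of_injective (I := I) hx)
  cases i with
  | zero =>
    obtain ⟨y, rfl⟩ := (LCoh.δ_exact J hs 0 z).mp (LCoh.eq_zero_of_injective J 0 _)
    have : Module.Injective R (tors J I) := injective_tors J
    have h1 : evalOne J I y ∈ tors J I := by rw [← range_evalOne]; exact ⟨y, rfl⟩
    obtain ⟨w, hw⟩ := smul_surjective_of_injective hx (⟨_, h1⟩ : tors J I)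
    have h2 : (w : I) ∈ LinearMap.range (evalOne J I) := (range_evalOne (M := I) J).ge w.2
    obtain ⟨v, hv⟩ := h2
    refine (LCoh.exact_δ J hs 0 y).mpr ⟨v, evalOne_injective J ?_⟩
    rw [evalOne_map, hv]
    exact congrArg Subtype.val hw
  | succ i =>
    obtain ⟨y, rfl⟩ := (LCoh.δ_exact J hs (i + 1) z).mp (LCoh.eq_zero_of_injective J _ _)
    rw [LCoh.eq_zero_of_injective J _ y, _root_.map_zero]

end Divisible

section BaseChange

variable {R : Type} [CommRing R]

lemma LCoh.eq_zero_of_injective_quotient [IsNoetherianRing R] (J : Ideal R) {x : R}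
    (hx : IsSMulRegular R x) {I : Type} [AddCommGroup I]
    [Module R I] [Module (R ⧸ Ideal.span {x}) I] [IsScalarTower R (R ⧸ Ideal.span {x}) I]
    [Module.Injective (R ⧸ Ideal.span {x}) I] (i : ℕ) (z : LCoh J (i + 1) I) : z = 0 := by
  obtain ⟨I', _, _, f, hI, hf⟩ := exists_injective_embedding (A := R) I
  have hx0 (m : I) : x • m = 0 := by
    rw [← algebraMap_smul (R ⧸ Ideal.span {x}) x m]
    have : algebraMap R (R ⧸ Ideal.span {x}) x = 0 :=
      Ideal.Quotient.eq_zero_iff_mem.mpr (Ideal.mem_span_singleton_self x)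
    rw [this, zero_smul]
  let g : I →ₗ[R] Submodule.torsionBy R I' x := f.codRestrict _ fun m => by
    rw [Submodule.mem_torsionBy_iff, ← _root_.map_smul, hx0, _root_.map_zero]
  let g' : I →ₗ[R ⧸ Ideal.span {x}] Submodule.torsionBy R I' x :=
    g.extendScalarsOfSurjective Ideal.Quotient.mk_surjective
  obtain ⟨r, hr⟩ := Module.Injective.out g'
    (fun a b hab => hf (congrArg Subtype.val hab)) LinearMap.id
  have h1 : (r.restrictScalars R) ∘ₗ g = LinearMap.id := LinearMap.ext hr
  have h2 : z = LCoh.map J (i + 1) (r.restrictScalars R) (LCoh.map J (i + 1) g z) := by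
    rw [← LinearMap.comp_apply, ← LCoh.map_comp, h1, LCoh.map_id]; rfl
  rw [h2, LCoh.eq_zero_torsionBy J hx i (LCoh.map J (i + 1) g z), _root_.map_zero]

end BaseChange

section BaseChange

variable {R : Type} [CommRing R] (J : Ideal R) {A : Type} [CommRing A] [Algebra R A]

variable (A) in
lemma mem_tors_map {N : Type} [AddCommGroup N]
    [Module R N] [Module A N] [IsScalarTower R A N] (m : N) :
    m ∈ tors (J.map (algebraMap R A)) N ↔ m ∈ tors J N := by
  refine exists_congr fun n => ?_
  rw [← Ideal.map_pow]
  constructor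
  · intro h r hr
    rw [← algebraMap_smul A r m]
    exact h _ (Ideal.mem_map_of_mem _ hr)
  · intro h r hr
    have : (J ^ n).map (algebraMap R A) ≤
        LinearMap.ker (LinearMap.toSpanSingleton A N m) := by
      rw [Ideal.map_le_iff_le_comap]
      intro r hr
      change algebraMap R A r • m = 0
      rw [algebraMap_smul, h r hr]
    exact this hr

variable (A) in
lemma exists_baseChange_zero (N : Type) [AddCommGroup N]
    [Module R N] [Module A N] [IsScalarTower R A N] :
    ∃ e : LCoh (J.map (algebraMap R A)) 0 N ≃+ LCoh J 0 N,
      ∀ z, evalOne J N (e z) = evalOne _ N z := by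
  have h : (LinearMap.range (evalOne (J.map (algebraMap R A)) N)).toAddSubgroup
      = (LinearMap.range (evalOne J N)).toAddSubgroup := by
    rw [range_evalOne, range_evalOne]
    ext m
    exact mem_tors_map J A m
  let e1 := LinearEquiv.ofInjective (evalOne (J.map (algebraMap R A)) N)
    (evalOne_injective _)
  let e2 := LinearEquiv.ofInjective (evalOne J N) (evalOne_injective _)
  refine ⟨e1.toAddEquiv.trans ((AddEquiv.addSubgroupCongr h).trans e2.toAddEquiv.symm),
    fun z => ?_⟩
  exact congrArg Subtype.val (e2.apply_symm_apply (AddEquiv.addSubgroupCongr h (e1 z)))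

lemma SES.restrictScalars {M N P : Type} [AddCommGroup M]
    [Module R M] [Module A M] [IsScalarTower R A M] [AddCommGroup N] [Module R N] [Module A N]
    [IsScalarTower R A N] [AddCommGroup P] [Module R P] [Module A P] [IsScalarTower R A P]
    {f : M →ₗ[A] N} {g : N →ₗ[A] P} (h : SES f g) :
    SES (f.restrictScalars R) (g.restrictScalars R) :=
  ⟨h.inj, h.exact, h.surj⟩

section Step

variable {N I Q : Type} [AddCommGroup N] [Module R N] [Module A N]
  [IsScalarTower R A N] [AddCommGroup I] [Module R I]
  [Module A I] [IsScalarTower R A I] [AddCommGroup Q]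
  [Module R Q] [Module A Q] [IsScalarTower R A Q]
  {f : N →ₗ[A] I} {g : I →ₗ[A] Q}

lemma exists_baseChange_of_δ (hs : SES f g) (i : ℕ)
    (hA : ∀ z : LCoh (J.map (algebraMap R A)) (i + 1) I, z = 0)
    (hR : ∀ z : LCoh J (i + 1) I, z = 0)
    (e : LCoh (J.map (algebraMap R A)) i Q ≃+ LCoh J i Q)
    (he : ∀ (r : R) z, e (algebraMap R A r • z) = r • e z)
    (hrange : ∀ c, c ∈ Set.range (LCoh.map (J.map (algebraMap R A)) i g) ↔
      e c ∈ Set.range (LCoh.map J i (g.restrictScalars R))) :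
    ∃ e : LCoh (J.map (algebraMap R A)) (i + 1) N ≃+ LCoh J (i + 1) N,
      ∀ (r : R) z, e (algebraMap R A r • z) = r • e z := by
  have hsR := hs.restrictScalars (R := R)
  have h1 : Function.Surjective (LCoh.δ (J.map (algebraMap R A)) hs i) :=
    fun z => (LCoh.δ_exact _ hs i z).mp (hA _)
  have h2 : Function.Surjective (LCoh.δ J hsR i) := fun z =>
    (LCoh.δ_exact J hsR i z).mp (hR _)
  let F := (LCoh.δ (J.map (algebraMap R A)) hs i).toAddMonoidHom
  let G := (LCoh.δ J hsR i).toAddMonoidHom.comp e.toAddMonoidHom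
  have hG : Function.Surjective G := h2.comp e.surjective
  have hFG (c) : F c = 0 ↔ G c = 0 := by
    have k1 := LCoh.exact_δ (J.map (algebraMap R A)) hs i c
    have k2 := LCoh.exact_δ J hsR i (e c)
    exact k1.trans ((hrange c).trans k2.symm)
  obtain ⟨E, hE⟩ := exists_addEquiv F G h1 hG hFG
  have hE' (y) : E (LCoh.δ _ hs i y) = LCoh.δ J hsR i (e y) := hE y
  refine ⟨E, fun r z => ?_⟩
  obtain ⟨y, rfl⟩ := h1 z
  rw [← _root_.map_smul, hE', hE', he, _root_.map_smul]

end Step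

/-- Independence of base for local cohomology. -/
theorem exists_baseChange_of_vanishing
    (hvan : ∀ (I : Type) [AddCommGroup I] [Module R I] [Module A I] [IsScalarTower R A I]
      [Module.Injective A I] (i : ℕ) (z : LCoh J (i + 1) I), z = 0) (i : ℕ) (N : Type)
    [AddCommGroup N] [Module R N] [Module A N] [IsScalarTower R A N] :
    ∃ e : LCoh (J.map (algebraMap R A)) i N ≃+ LCoh J i N,
      ∀ (r : R) z, e (algebraMap R A r • z) = r • e z := by
  induction i generalizing N with
  | zero =>
    obtain ⟨e, he⟩ := exists_baseChange_zero J A N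
    refine ⟨e, fun r z => evalOne_injective J ?_⟩
    rw [he, _root_.map_smul, _root_.map_smul, he]
    exact algebraMap_smul A r _
  | succ i ih =>
    obtain ⟨I, _, _, f, hI, hf⟩ := exists_injective_embedding (A := A) N
    let _ : Module R I := Module.compHom I (algebraMap R A)
    have _ : IsScalarTower R A I := .of_algebraMap_smul fun _ _ => rfl
    have hs := SES.ofInjective hf
    cases i with
    | zero =>
      obtain ⟨e, he⟩ := exists_baseChange_zero J A (I ⧸ LinearMap.range f)
      obtain ⟨e', he'⟩ := exists_baseChange_zero J A I
      refine exists_baseChange_of_δ J hs 0 (LCoh.eq_zero_of_injective _ 0)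
        (hvan I 0) e (fun r z => evalOne_injective J ?_)
        fun c => ⟨?_, ?_⟩
      · rw [he, _root_.map_smul, _root_.map_smul, he]
        exact algebraMap_smul A r _
      · rintro ⟨w, rfl⟩
        refine ⟨e' w, evalOne_injective J ?_⟩
        rw [evalOne_map, he', he, evalOne_map]
        rfl
      · rintro ⟨w, hw⟩
        obtain ⟨w, rfl⟩ := e'.surjective w
        refine ⟨w, evalOne_injective _ ?_⟩
        rw [evalOne_map, ← he, ← hw, evalOne_map, he']
        rfl
    | succ i =>
      obtain ⟨e, he⟩ := ih (I ⧸ LinearMap.range f)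
      refine exists_baseChange_of_δ J hs (i + 1) (LCoh.eq_zero_of_injective _ _)
        (hvan I _) e he fun c => ⟨?_, ?_⟩
      · rintro ⟨w, rfl⟩
        refine ⟨0, ?_⟩
        rw [LCoh.eq_zero_of_injective _ _ w, _root_.map_zero, _root_.map_zero, _root_.map_zero]
      · rintro ⟨w, hw⟩
        rw [hvan I _ w, _root_.map_zero] at hw
        exact ⟨0, by rw [_root_.map_zero, e.injective (hw.symm.trans e.map_zero.symm)]⟩

end BaseChange

/-- Local cohomology over a quotient ring. -/
theorem exists_baseChange {R : Type} [CommRing R] [IsNoetherianRing R] (J : Ideal R) {x : R}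
    (hx : IsSMulRegular R x) (i : ℕ) (N : Type) [AddCommGroup N] [Module R N]
    [Module (R ⧸ Ideal.span {x}) N] [IsScalarTower R (R ⧸ Ideal.span {x}) N] :
    ∃ e : LCoh (J.map (Ideal.Quotient.mk (Ideal.span {x}))) i N ≃+ LCoh J i N,
      ∀ (r : R) z, e (Ideal.Quotient.mk (Ideal.span {x}) r • z) = r • e z :=
  exists_baseChange_of_vanishing J
    (fun I _ _ _ _ _ => LCoh.eq_zero_of_injective_quotient J hx (I := I)) i N

section Attached

variable {R : Type} [CommRing R]

lemma mem_annihilator_quotient {H : Type} [AddCommGroup H] [Module R H] {N : Submodule R H}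
    {a : R} : a ∈ Module.annihilator R (H ⧸ N) ↔ ∀ h : H, a • h ∈ N := by
  rw [Module.mem_annihilator]
  constructor
  · intro h m
    exact (Submodule.Quotient.mk_eq_zero N).mp (h (Submodule.Quotient.mk m))
  · intro h m
    obtain ⟨m, rfl⟩ := Submodule.Quotient.mk_surjective _ m
    exact (Submodule.Quotient.mk_eq_zero N).mpr (h m)

/-- An element avoids all attached primes if and only if it acts surjectively. -/
lemma forall_notMem_attachedPrimes_iff [IsNoetherianRing R] (H : Type) [AddCommGroup H]
    [Module R H] (x : R) :
    (∀ p ∈ attachedPrimes R H, x ∉ p) ↔ Function.Surjective (LinearMap.lsmul R H x) := by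
  constructor
  · intro h
    by_contra hx
    let s : Set (Ideal R) := {p | ∃ N : Submodule R H, N ≠ ⊤ ∧ (∀ h : H, x • h ∈ N) ∧
      p = Module.annihilator R (H ⧸ N)}
    have hs : s.Nonempty := ⟨_, LinearMap.range (LinearMap.lsmul R H x),
      fun h => hx (LinearMap.range_eq_top.mp h), fun h => ⟨h, rfl⟩, rfl⟩
    obtain ⟨p, ⟨N, hN, hxN, rfl⟩, hmax⟩ := set_has_maximal_iff_noetherian.mpr ‹_› s hs
    refine h _ ⟨⟨fun h1 => hN ?_, fun {a b} hab => ?_⟩, N, rfl⟩ (mem_annihilator_quotient.mpr hxN)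
    · refine eq_top_iff.mpr fun m _ => ?_
      have := mem_annihilator_quotient.mp ((Ideal.eq_top_iff_one _).mp h1) m
      rwa [one_smul] at this
    · by_contra! hcon
      have h1 : N ⊔ LinearMap.range (LinearMap.lsmul R H b) = ⊤ := by
        by_contra hne
        refine hmax _ ⟨_, hne, fun h => le_sup_left (a := N) (hxN h), rfl⟩ ?_
        refine lt_of_le_of_ne (fun r hr => ?_) fun heq => hcon.2 ?_
        · exact mem_annihilator_quotient.mpr fun h =>
            le_sup_left (a := N) (mem_annihilator_quotient.mp hr h)
        · rw [heq]
          exact mem_annihilator_quotient.mpr fun h => le_sup_right (a := N) ⟨h, rfl⟩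
      refine hcon.1 (mem_annihilator_quotient.mpr fun m => ?_)
      obtain ⟨n, hn, _, ⟨k, rfl⟩, rfl⟩ := Submodule.mem_sup.mp (h1.ge (Submodule.mem_top (x := m)))
      rw [smul_add]
      refine N.add_mem (N.smul_mem _ hn) ?_
      have := mem_annihilator_quotient.mp hab k
      rwa [mul_smul] at this
  · rintro h p ⟨hp, N, rfl⟩ hx
    refine hp.ne_top ((Ideal.eq_top_iff_one _).mpr (mem_annihilator_quotient.mpr fun m => ?_))
    obtain ⟨m, rfl⟩ := h m
    rw [one_smul]
    exact mem_annihilator_quotient.mp hx m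

end Attached

section Hull

variable {S : Type} [CommRing S] {J : Ideal S} {E E' : Type} [AddCommGroup E] [Module S E]
  [AddCommGroup E'] [Module S E']

lemma injective_of_equiv (e : E ≃ₗ[S] E') [Module.Injective S E] : Module.Injective S E' where
  out _ _ _ _ _ _ f hf g := by
    obtain ⟨h, hh⟩ := Module.Injective.out f hf (e.symm.toLinearMap ∘ₗ g)
    exact ⟨e.toLinearMap ∘ₗ h, fun x => by simp [hh]⟩

lemma isInjHull_of_equiv (e : E ≃ₗ[S] E') (h : IsInjHull S J E) : IsInjHull S J E' := by
  obtain ⟨hI, f, hf, hess⟩ := h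
  refine ⟨injective_of_equiv e, e.toLinearMap ∘ₗ f, e.injective.comp hf, fun N hN hbot => ?_⟩
  refine hess (N.comap e.toLinearMap) (fun h => hN ?_) ?_
  · refine (Submodule.eq_bot_iff _).mpr fun y hy => ?_
    have : e.symm y ∈ N.comap e.toLinearMap := by simpa using hy
    rw [h, Submodule.mem_bot] at this
    simpa using this
  · refine (Submodule.eq_bot_iff _).mpr ?_
    rintro _ ⟨hy, z, rfl⟩
    have : e (f z) ∈ N ⊓ LinearMap.range (e.toLinearMap ∘ₗ f) := ⟨hy, z, rfl⟩
    rw [hbot, Submodule.mem_bot] at this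
    simpa using this

lemma nonempty_equiv_of_isInjHull (h : IsInjHull S J E) (h' : IsInjHull S J E') :
    Nonempty (E ≃ₗ[S] E') := by
  obtain ⟨hI, f, hf, hess⟩ := h
  obtain ⟨hI', f', hf', hess'⟩ := h'
  obtain ⟨g, hg⟩ := Module.Injective.out f hf f'
  have hginj : Function.Injective g := by
    rw [← LinearMap.ker_eq_bot]
    by_contra hne
    refine hess _ hne ((Submodule.eq_bot_iff _).mpr ?_)
    rintro _ ⟨hy, z, rfl⟩
    have : f' z = 0 := (hg z).symm.trans hy
    rw [(map_eq_zero_iff _ hf').mp this, map_zero]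
  obtain ⟨r, hr⟩ := Module.Injective.out g hginj LinearMap.id
  have hrinj : Function.Injective r := by
    rw [← LinearMap.ker_eq_bot]
    by_contra hne
    refine hess' _ hne ((Submodule.eq_bot_iff _).mpr ?_)
    rintro _ ⟨hy, z, rfl⟩
    rw [← hg] at hy
    have : f z = 0 := (hr (f z)).symm.trans hy
    rw [(map_eq_zero_iff _ hf).mp this, map_zero]
  exact ⟨LinearEquiv.ofBijective g ⟨hginj, fun y => ⟨r y, hrinj (hr (r y))⟩⟩⟩

/-- The injective hull of the residue field is a cogenerator. -/
lemma exists_apply_ne_zero [IsLocalRing S] (h : IsInjHull S (maximalIdeal S) E)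
    {M : Type} [AddCommGroup M] [Module S M] {m : M} (hm : m ≠ 0) : ∃ g : M →ₗ[S] E, g m ≠ 0 := by
  obtain ⟨hI, f, hf, -⟩ := h
  have hker : LinearMap.ker (LinearMap.toSpanSingleton S M m) ≤ maximalIdeal S := by
    refine le_maximalIdeal fun h => hm ?_
    have : (1 : S) ∈ LinearMap.ker (LinearMap.toSpanSingleton S M m) := h ▸ Submodule.mem_top
    simpa using this
  obtain ⟨g, hg⟩ := Module.Injective.out
    ((LinearMap.ker (LinearMap.toSpanSingleton S M m)).liftQ _ le_rfl)
    (LinearMap.ker_eq_bot.mp (Submodule.ker_liftQ_eq_bot _ _ _ le_rfl))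
    (f ∘ₗ Submodule.mapQ _ (maximalIdeal S) LinearMap.id hker)
  refine ⟨g, fun h0 => ?_⟩
  have := hg (Submodule.Quotient.mk 1)
  rw [Submodule.liftQ_apply, LinearMap.toSpanSingleton_apply, one_smul, h0] at this
  have h1 : (Submodule.Quotient.mk (1 : S) : S ⧸ maximalIdeal S) = 0 :=
    hf (this.symm.trans (map_zero f).symm)
  rw [Submodule.Quotient.mk_eq_zero] at h1
  exact (maximalIdeal.isMaximal S).ne_top ((Ideal.eq_top_iff_one _).mpr h1)

/-- The `x`-torsion of an injective hull is an injective hull over the quotient by `x`. -/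
lemma isInjHull_torsionBy (h : IsInjHull S J E) {x : S} (hx : x ∈ J) :
    IsInjHull (S ⧸ Ideal.span {x}) (J.map (Ideal.Quotient.mk (Ideal.span {x})))
      (Submodule.torsionBy S E x) := by
  obtain ⟨hI, f, hf, hess⟩ := h
  refine ⟨⟨fun X Y _ _ _ _ u hu g => ?_⟩, ?_⟩
  · let _ : Module S X := Module.compHom X (algebraMap S (S ⧸ Ideal.span {x}))
    let _ : Module S Y := Module.compHom Y (algebraMap S (S ⧸ Ideal.span {x}))
    have _ : IsScalarTower S (S ⧸ Ideal.span {x}) X := .of_algebraMap_smul fun _ _ => rfl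
    have _ : IsScalarTower S (S ⧸ Ideal.span {x}) Y := .of_algebraMap_smul fun _ _ => rfl
    obtain ⟨v, hv⟩ := Module.Injective.out (u.restrictScalars S) hu
      ((Submodule.torsionBy S E x).subtype ∘ₗ g.restrictScalars S)
    have hx0 (m : Y) : x • m = 0 := by
      rw [← algebraMap_smul (S ⧸ Ideal.span {x}) x m]
      have : algebraMap S (S ⧸ Ideal.span {x}) x = 0 :=
        Ideal.Quotient.eq_zero_iff_mem.mpr (Ideal.mem_span_singleton_self x)
      rw [this, zero_smul]
    let w : Y →ₗ[S] Submodule.torsionBy S E x := v.codRestrict _ fun m => by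
      rw [Submodule.mem_torsionBy_iff, ← map_smul, hx0, map_zero]
    exact ⟨w.extendScalarsOfSurjective Ideal.Quotient.mk_surjective, fun m => Subtype.ext (hv m)⟩
  · have hJ (r : S) (hr : r ∈ J) : r • f (Submodule.Quotient.mk 1) = 0 := by
      rw [← map_smul, ← Submodule.Quotient.mk_smul, (Submodule.Quotient.mk_eq_zero _).mpr,
        map_zero]
      simpa using hr
    let e : Submodule.torsionBy S E x := ⟨f (Submodule.Quotient.mk 1), hJ x hx⟩
    have hle : J.map (Ideal.Quotient.mk (Ideal.span {x})) ≤
        LinearMap.ker (LinearMap.toSpanSingleton (S ⧸ Ideal.span {x}) _ e) := by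
      rw [Ideal.map_le_iff_le_comap]
      exact fun r hr => Subtype.ext (hJ r hr)
    have hval (r : S) : ((Submodule.liftQ _ _ hle (Submodule.Quotient.mk
        (Ideal.Quotient.mk (Ideal.span {x}) r)) : Submodule.torsionBy S E x) : E) =
        f (Submodule.Quotient.mk r) := by
      have : (Submodule.Quotient.mk r : S ⧸ J) = r • Submodule.Quotient.mk 1 := by
        rw [← Submodule.Quotient.mk_smul, smul_eq_mul, mul_one]
      rw [this, map_smul]
      rfl
    refine ⟨Submodule.liftQ _ _ hle, ?_, fun N hN hbot => ?_⟩
    · rw [injective_iff_map_eq_zero]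
      intro a ha
      obtain ⟨a, rfl⟩ := Submodule.Quotient.mk_surjective _ a
      obtain ⟨r, rfl⟩ := Ideal.Quotient.mk_surjective a
      have h1 := hval r
      rw [ha] at h1
      have h2 := (Submodule.Quotient.mk_eq_zero _).mp ((map_eq_zero_iff f hf).mp h1.symm)
      exact (Submodule.Quotient.mk_eq_zero _).mpr (Ideal.mem_map_of_mem _ h2)
    · refine hess ((N.restrictScalars S).map (Submodule.torsionBy S E x).subtype) (fun h => hN ?_)
        ((Submodule.eq_bot_iff _).mpr ?_)
      · refine (Submodule.eq_bot_iff _).mpr fun y hy => ?_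
        have : (y : E) ∈ (N.restrictScalars S).map (Submodule.torsionBy S E x).subtype :=
          ⟨y, hy, rfl⟩
        rw [h, Submodule.mem_bot] at this
        exact Subtype.ext this
      · rintro _ ⟨⟨y, hy, rfl⟩, z, hz⟩
        obtain ⟨r, rfl⟩ := Submodule.Quotient.mk_surjective _ z
        have : y ∈ N ⊓ LinearMap.range (Submodule.liftQ _ _ hle) :=
          ⟨hy, Submodule.Quotient.mk (Ideal.Quotient.mk (Ideal.span {x}) r),
            Subtype.ext ((hval r).trans hz)⟩
        rw [hbot, Submodule.mem_bot] at this
        rw [this]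
        rfl

end Hull

section Regular

variable {A : Type} [CommRing A] (J : Ideal A)
variable {N Q : Type} [AddCommGroup N] [Module A N] [AddCommGroup Q] [Module A Q]

lemma SES.mkQ_span {x : A} (hx : IsSMulRegular A x) :
    SES (LinearMap.lsmul A A x) (Submodule.mkQ (Ideal.span {x})) := by
  refine ⟨hx, fun y => ?_, Submodule.mkQ_surjective _⟩
  rw [Submodule.mkQ_apply, Submodule.Quotient.mk_eq_zero, Ideal.mem_span_singleton']
  exact exists_congr fun a => by rw [LinearMap.lsmul_apply, smul_eq_mul, mul_comm]

lemma range_δ {y : A} {q : N →ₗ[A] Q} (h : SES (LinearMap.lsmul A N y) q) (i : ℕ) :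
    LinearMap.range (LCoh.δ J h i) = Submodule.torsionBy A (LCoh J (i + 1) N) y := by
  ext z
  rw [Submodule.mem_torsionBy_iff, ← LCoh.map_lsmul]
  exact (LCoh.δ_exact J h i z).symm

lemma ker_δ {P : Type} [AddCommGroup P] [Module A P] {f : N →ₗ[A] P} {q : P →ₗ[A] Q}
    (h : SES f q) (i : ℕ) :
    LinearMap.ker (LCoh.δ J h i) = LinearMap.range (LCoh.map J i q) := by
  ext z
  exact LCoh.exact_δ J h i z

lemma δ_injective_of_surjective {y : A} {q : N →ₗ[A] Q} (h : SES (LinearMap.lsmul A N y) q) (i : ℕ)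
    (hy : Function.Surjective (LinearMap.lsmul A (LCoh J i N) y)) :
    Function.Injective (LCoh.δ J h i) := by
  rw [← LinearMap.ker_eq_bot, ker_δ, LinearMap.range_eq_bot]
  ext z
  obtain ⟨z, rfl⟩ := hy z
  rw [LinearMap.lsmul_apply, ← LCoh.map_lsmul]
  exact (LCoh.exact_map J h i).apply_apply_eq_zero z

lemma surjective_of_δ_injective {y : A} {q : N →ₗ[A] Q} (h : SES (LinearMap.lsmul A N y) q) (i : ℕ)
    (hy : Function.Injective (LCoh.δ J h i)) :
    Function.Surjective (LinearMap.lsmul A (LCoh J i N) y) := by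
  rw [← LinearMap.ker_eq_bot, ker_δ, LinearMap.range_eq_bot] at hy
  intro z
  obtain ⟨w, rfl⟩ := (LCoh.exact_map J h i z).mp (by rw [hy]; rfl)
  exact ⟨w, (LCoh.map_lsmul J i y w).symm⟩

end Regular

section Gorenstein

/-- Additive equivalences compatible with the scalars of a ring surjecting onto `A` are linear. -/
lemma exists_linearEquiv {R A : Type} [CommRing R] [CommRing A] [Algebra R A]
    (hA : Function.Surjective (algebraMap R A)) {X Y : Type} [AddCommGroup X] [Module A X]
    [AddCommGroup Y] [Module A Y] [Module R Y] [IsScalarTower R A Y] (e : X ≃+ Y)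
    (he : ∀ (r : R) z, e (algebraMap R A r • z) = r • e z) : Nonempty (X ≃ₗ[A] Y) :=
  ⟨{ e with
      map_smul' := fun a z => by
        obtain ⟨r, rfl⟩ := hA a
        exact (he r z).trans (algebraMap_smul A r (e z)).symm }⟩

variable {R : Type} [CommRing R]

lemma isInjHull_of_isQuasiGorensteinAt {J : Ideal R} {d : ℕ}
    (hd : ringKrullDim R = (d : WithBot ℕ∞)) (h : IsQuasiGorensteinAt R J) :
    IsInjHull R J (LCoh J d R) := by
  obtain ⟨d', hd', E, hE, ⟨e⟩⟩ := h
  obtain rfl : d = d' := by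
    rw [hd] at hd'
    exact_mod_cast hd'
  exact isInjHull_of_equiv (e.symm ≪≫ₗ lcEquiv J d (ModuleCat.of R R)) hE

lemma isQuasiGorensteinAt_of_isInjHull {J : Ideal R} {d : ℕ}
    (hd : ringKrullDim R = (d : WithBot ℕ∞)) {E : Type} [AddCommGroup E] [Module R E]
    (hE : IsInjHull R J E) (e : LCoh J d R ≃ₗ[R] E) : IsQuasiGorensteinAt R J :=
  ⟨d, hd, ModuleCat.of R E, hE, ⟨lcEquiv J d (ModuleCat.of R R) ≪≫ₗ e⟩⟩

variable [IsNoetherianRing R] {J : Ideal R} {x : R}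

lemma isQuasiGorensteinAt_quotient_of_surjective (hx : IsSMulRegular R x) (hxJ : x ∈ J) {e : ℕ}
    (hd : ringKrullDim (R ⧸ Ideal.span {x}) = (e : WithBot ℕ∞))
    (hE : IsInjHull R J (LCoh J (e + 1) R))
    (hs : Function.Surjective (LinearMap.lsmul R (LCoh J e R) x)) :
    IsQuasiGorensteinAt (R ⧸ Ideal.span {x}) (J.map (Ideal.Quotient.mk (Ideal.span {x}))) := by
  have h := SES.mkQ_span hx
  let g : LCoh J e (R ⧸ Ideal.span {x}) ≃ₗ[R] Submodule.torsionBy R (LCoh J (e + 1) R) x :=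
    LinearEquiv.ofInjective (LCoh.δ J h e) (δ_injective_of_surjective J h e hs) ≪≫ₗ
      LinearEquiv.ofEq _ _ (range_δ J h e)
  obtain ⟨b, hb⟩ := exists_baseChange J hx e (R ⧸ Ideal.span {x})
  obtain ⟨u⟩ := exists_linearEquiv (R := R) (A := R ⧸ Ideal.span {x})
    Ideal.Quotient.mk_surjective (b.trans g.toAddEquiv)
    (fun r z => (congrArg g (hb r z)).trans (g.map_smul r (b z)))
  exact isQuasiGorensteinAt_of_isInjHull hd (isInjHull_torsionBy hE hxJ) u

/-- If the quotient by `x` is quasi-Gorenstein, its local cohomology is the `x`-torsion of `E`. -/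
lemma nonempty_equiv_torsionBy (hx : IsSMulRegular R x) (hxJ : x ∈ J) {e : ℕ}
    (hd : ringKrullDim (R ⧸ Ideal.span {x}) = (e : WithBot ℕ∞)) {E : Type} [AddCommGroup E]
    [Module R E] (hE : IsInjHull R J E)
    (h : IsQuasiGorensteinAt (R ⧸ Ideal.span {x}) (J.map (Ideal.Quotient.mk (Ideal.span {x})))) :
    Nonempty (LCoh J e (R ⧸ Ideal.span {x}) ≃ₗ[R] Submodule.torsionBy R E x) := by
  obtain ⟨u⟩ := nonempty_equiv_of_isInjHull (isInjHull_of_isQuasiGorensteinAt hd h)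
    (isInjHull_torsionBy hE hxJ)
  obtain ⟨b, hb⟩ := exists_baseChange J hx e (R ⧸ Ideal.span {x})
  refine ⟨{ b.symm.trans u.toAddEquiv with map_smul' := fun r z => ?_ }⟩
  obtain ⟨z, rfl⟩ := b.surjective z
  rw [← hb]
  simp [show u (Ideal.Quotient.mk (Ideal.span {x}) r • z) = _ from u.map_smul _ z]

end Gorenstein

section FlatBaseChange

variable {R : Type} [CommRing R] {S : Type} [CommRing S] [Algebra R S]

lemma injective_of_flat [Module.Flat R S] (I : Type) [AddCommGroup I] [Module R I] [Module S I]
    [IsScalarTower R S I] [Module.Injective S I] : Module.Injective R I := by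
  refine ⟨fun X Y _ _ _ _ f hf g => ?_⟩
  have h1 : Function.Injective (f.baseChange S) :=
    Module.Flat.lTensor_preserves_injective_linearMap f hf
  obtain ⟨h, hh⟩ := Module.Injective.out (f.baseChange S) h1 (LinearMap.liftBaseChange S g)
  refine ⟨(h.restrictScalars R).comp (TensorProduct.mk R S Y 1), fun x => ?_⟩
  have := hh (1 ⊗ₜ x)
  simpa using this

/-- Local cohomology is compatible with flat base change on modules over the target. -/
theorem exists_flat_baseChange (J : Ideal R) [Module.Flat R S] (i : ℕ)
    (N : Type) [AddCommGroup N] [Module R N] [Module S N] [IsScalarTower R S N] :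
    ∃ e : LCoh (J.map (algebraMap R S)) i N ≃+ LCoh J i N,
      ∀ (r : R) z, e (algebraMap R S r • z) = r • e z := by
  refine exists_baseChange_of_vanishing J (fun I _ _ _ _ _ i z => ?_) i N
  have := injective_of_flat (R := R) (S := S) I
  exact LCoh.eq_zero_of_injective J i z

end FlatBaseChange

section FlatVanishing

variable {R : Type} [CommRing R]

lemma exists_ext_factor [IsNoetherianRing R] {D : Type} [AddCommGroup D] [Module R D]
    [Module.Flat R D] (i : ℕ)
    (M : Type) [AddCommGroup M] [Module R M] [Module.Finite R M]
    (a : Abelian.Ext (ModuleCat.of R M) (ModuleCat.of R D) i) :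
    ∃ (n : ℕ) (b : Abelian.Ext (ModuleCat.of R M) (ModuleCat.of R (Fin n →₀ R)) i)
      (f : (Fin n →₀ R) →ₗ[R] D),
      a = b.comp (Abelian.Ext.mk₀ (ModuleCat.ofHom f)) (add_zero i) := by
  induction i generalizing M with
  | zero =>
    obtain ⟨g, rfl⟩ := Abelian.Ext.homEquiv₀.symm.surjective a
    have := Module.finitePresentation_of_finite R M
    obtain ⟨n, b, f, h⟩ := Module.Flat.exists_factorization_of_finitePresentation g.hom
    refine ⟨n, Abelian.Ext.mk₀ (ModuleCat.ofHom b), f, ?_⟩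
    rw [Abelian.Ext.mk₀_comp_mk₀, ← ModuleCat.ofHom_comp, ← h]
    rfl
  | succ i ih =>
    obtain ⟨n, p, hp⟩ := Module.Finite.exists_fin' R M
    have hs := SES.ofSurjective hp
    have : Projective (ModuleCat.of R (Fin n → R)) := by infer_instance
    obtain ⟨b, hb⟩ := Abelian.Ext.contravariant_sequence_exact₃ hs.shortExact
      (ModuleCat.of R D) a (Abelian.Ext.eq_zero_of_projective _) (add_comm 1 i)
    obtain ⟨k, c, f, rfl⟩ := ih _ b
    refine ⟨k, hs.shortExact.extClass.comp c (add_comm 1 i), f, ?_⟩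
    rw [← hb]
    exact (Abelian.Ext.comp_assoc _ _ _ (add_comm 1 i) (add_zero i) (by lia)).symm

lemma LCoh.eq_zero_of_flat [IsNoetherianRing R] {D : Type} [AddCommGroup D] [Module R D]
    [Module.Flat R D] (J : Ideal R) (hJ : J • (⊤ : Submodule R D) = ⊤) (i : ℕ) (z : LCoh J i D) :
    z = 0 := by
  have hJn (n : ℕ) : J ^ n • (⊤ : Submodule R D) = ⊤ := by
    induction n with
    | zero => simp
    | succ n ih => rw [pow_succ, Submodule.mul_smul, hJ, ih]
  obtain ⟨n, a, rfl⟩ := exists_ofExt J z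
  suffices a = 0 by rw [this, _root_.map_zero]
  obtain ⟨k, b, f, rfl⟩ := exists_ext_factor i (R ⧸ J ^ n) a
  let Φ : ((Fin k →₀ R) →ₗ[R] D) →ₗ[R] extPow J n i D :=
    { toFun f := b.comp (Abelian.Ext.mk₀ (ModuleCat.ofHom f)) (add_zero i)
      map_add' f g := by
        rw [ModuleCat.ofHom_add, Abelian.Ext.mk₀_add, Abelian.Ext.comp_add]
      map_smul' r f := by
        have : ModuleCat.ofHom (r • f) = r • ModuleCat.ofHom f := rfl
        rw [this, Abelian.Ext.mk₀_smul, Abelian.Ext.comp_smul]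
        rfl }
  have h1 : J ^ n • (⊤ : Submodule R ((Fin k →₀ R) →ₗ[R] D)) ≤ LinearMap.ker Φ := by
    refine Submodule.smul_le.mpr fun r hr f _ => ?_
    rw [LinearMap.mem_ker, _root_.map_smul]
    exact extPow_smul_eq_zero J hr _
  have h2 : f ∈ J ^ n • (⊤ : Submodule R ((Fin k →₀ R) →ₗ[R] D)) := by
    have : f = ∑ j, (LinearMap.toSpanSingleton R D (f (Finsupp.single j 1))).comp
        (Finsupp.lapply j) := by
      ext j
      simp [Finsupp.single_apply, Finset.sum_ite_eq]
    rw [this]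
    refine Submodule.sum_mem _ fun j _ => ?_
    let L : D →ₗ[R] ((Fin k →₀ R) →ₗ[R] D) :=
      (LinearMap.lcomp R D (Finsupp.lapply j)).comp
        ((LinearMap.ringLmapEquivSelf R R D).symm : D →ₗ[R] (R →ₗ[R] D))
    have h3 : f (Finsupp.single j 1) ∈ J ^ n • (⊤ : Submodule R D) := by rw [hJn]; trivial
    have h4 := Submodule.mem_map_of_mem (f := L) h3
    rw [Submodule.map_smul''] at h4
    exact Submodule.smul_mono le_rfl le_top h4
  exact h1 h2

end FlatVanishing

section Comparison

lemma LCoh.map_bijective_of_vanishing {A : Type} [CommRing A] (J : Ideal A) {M N P : Type}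
    [AddCommGroup M] [Module A M] [AddCommGroup N] [Module A N] [AddCommGroup P] [Module A P]
    {f : M →ₗ[A] N} {g : N →ₗ[A] P} (h : SES f g) (hP : ∀ i (z : LCoh J i P), z = 0) (i : ℕ) :
    Function.Bijective (LCoh.map J i f) := by
  constructor
  · cases i with
    | zero =>
      refine fun a b hab => evalOne_injective J (h.inj ?_)
      rw [← evalOne_map, ← evalOne_map, hab]
    | succ i =>
      refine (injective_iff_map_eq_zero _).mpr fun z hz => ?_
      obtain ⟨w, rfl⟩ := (LCoh.δ_exact J h i z).mp hz
      rw [hP i w, _root_.map_zero]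
  · exact fun z => (LCoh.exact_map J h i z).mp (hP i _)

variable {R : Type} [CommRing R] {S : Type} [CommRing S] [Algebra R S]

open TensorProduct in
lemma flat_cokernel [Module.FaithfullyFlat R S] :
    Module.Flat R (S ⧸ LinearMap.range (Algebra.linearMap R S)) := by
  rw [Module.Flat.iff_lift_lsmul_comp_subtype_injective]
  intro I hI
  let q := (LinearMap.range (Algebra.linearMap R S)).mkQ
  let μ (M : Type) [AddCommGroup M] [Module R M] : I ⊗[R] M →ₗ[R] M :=
    TensorProduct.lift ((LinearMap.lsmul R M).comp I.subtype)
  have hq : q.comp (μ S) = (μ _).comp (q.lTensor I) := by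
    ext a b
    simp [μ]
  have hμ (t : I ⊗[R] S) : μ S t ∈ I.map (algebraMap R S) := by
    induction t with
    | zero => simp
    | add a b ha hb => rw [_root_.map_add]; exact add_mem ha hb
    | tmul a b =>
      simp only [μ, TensorProduct.lift.tmul, LinearMap.comp_apply, Submodule.subtype_apply,
        LinearMap.lsmul_apply, Algebra.smul_def]
      exact Ideal.mul_mem_right _ _ (Ideal.mem_map_of_mem _ a.2)
  refine (injective_iff_map_eq_zero _).mpr fun t ht => ?_
  obtain ⟨t, rfl⟩ := LinearMap.lTensor_surjective I (Submodule.mkQ_surjective _) t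
  have h1 : q (μ S t) = 0 := (LinearMap.congr_fun hq t).trans ht
  obtain ⟨a, ha⟩ := (Submodule.Quotient.mk_eq_zero _).mp h1
  have haI : a ∈ I := by
    rw [← Ideal.comap_map_eq_self_of_faithfullyFlat (B := S) I, Ideal.mem_comap]
    have := hμ t
    rwa [← ha] at this
  have h2 : t = (⟨a, haI⟩ : I) ⊗ₜ 1 := by
    refine Module.Flat.iff_lift_lsmul_comp_subtype_injective.mp inferInstance hI ?_
    change μ S t = _
    rw [← ha]
    simp [Algebra.smul_def]
  rw [h2, LinearMap.lTensor_tmul]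
  have h3 : q 1 = 0 := (Submodule.Quotient.mk_eq_zero _).mpr ⟨1, by simp⟩
  exact (congrArg (TensorProduct.tmul R (⟨a, haI⟩ : I)) h3).trans (TensorProduct.tmul_zero _ _)

lemma smul_top_cokernel (J : Ideal R)
    (h : ∀ s : S, ∃ r : R, s - algebraMap R S r ∈ J.map (algebraMap R S)) :
    J • (⊤ : Submodule R (S ⧸ LinearMap.range (Algebra.linearMap R S))) = ⊤ := by
  refine eq_top_iff.mpr fun z _ => ?_
  obtain ⟨s, rfl⟩ := Submodule.Quotient.mk_surjective _ z
  obtain ⟨r, hr⟩ := h s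
  have h1 : (Submodule.Quotient.mk s : S ⧸ LinearMap.range (Algebra.linearMap R S)) =
      (LinearMap.range (Algebra.linearMap R S)).mkQ (s - algebraMap R S r) := by
    rw [Submodule.mkQ_apply, Submodule.Quotient.mk_sub, eq_comm, sub_eq_self,
      Submodule.Quotient.mk_eq_zero]
    exact ⟨r, rfl⟩
  rw [h1]
  have h2 : s - algebraMap R S r ∈ J • (⊤ : Submodule R S) := by
    rw [Ideal.smul_top_eq_map]
    exact hr
  have h3 := Submodule.mem_map_of_mem (f := (LinearMap.range (Algebra.linearMap R S)).mkQ) h2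
  rw [Submodule.map_smul''] at h3
  exact Submodule.smul_mono le_rfl le_top h3

variable [Module.FaithfullyFlat R S] (J : Ideal R)

theorem LCoh.map_linearMap_bijective [IsNoetherianRing R]
    (h : ∀ s : S, ∃ r : R, s - algebraMap R S r ∈ J.map (algebraMap R S)) (i : ℕ) :
    Function.Bijective (LCoh.map J i (Algebra.linearMap R S)) := by
  have := flat_cokernel (R := R) (S := S)
  exact LCoh.map_bijective_of_vanishing J
    (SES.ofInjective (f := Algebra.linearMap R S) (FaithfulSMul.algebraMap_injective R S))
    (LCoh.eq_zero_of_flat J (smul_top_cokernel J h)) i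

variable (S) in
/-- The map `R/xR → S/xS`. -/
def quotientMap (x : R) :
    (R ⧸ Ideal.span {x}) →ₗ[R] (S ⧸ Ideal.span {algebraMap R S x}) :=
  Submodule.liftQ (Ideal.span {x})
    (((Ideal.span {algebraMap R S x}).mkQ.restrictScalars R).comp (Algebra.linearMap R S)) (by
      refine (Ideal.span_singleton_le_iff_mem _).mpr ?_
      exact (Submodule.Quotient.mk_eq_zero _).mpr (Ideal.mem_span_singleton_self _))

lemma quotientMap_injective (x : R) : Function.Injective (quotientMap S x) := by
  refine (injective_iff_map_eq_zero _).mpr fun z hz => ?_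
  obtain ⟨r, rfl⟩ := Submodule.Quotient.mk_surjective _ z
  have h1 : algebraMap R S r ∈ Ideal.span {algebraMap R S x} :=
    (Submodule.Quotient.mk_eq_zero _).mp hz
  rw [← Set.image_singleton, ← Ideal.map_span, ← Ideal.mem_comap,
    Ideal.comap_map_eq_self_of_faithfullyFlat] at h1
  exact (Submodule.Quotient.mk_eq_zero _).mpr h1

theorem LCoh.map_quotientMap_bijective [IsNoetherianRing R]
    (h : ∀ s : S, ∃ r : R, s - algebraMap R S r ∈ J.map (algebraMap R S)) {x : R}
    (hx : IsSMulRegular R x) (i : ℕ) :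
    Function.Bijective (LCoh.map J i (quotientMap S x)) := by
  have hflat := flat_cokernel (R := R) (S := S)
  have hD := LCoh.eq_zero_of_flat J (smul_top_cokernel J h)
  have hs := SES.ofInjective (quotientMap_injective (S := S) x)
  refine LCoh.map_bijective_of_vanishing J hs (fun i z => ?_) i
  let q : (S ⧸ LinearMap.range (Algebra.linearMap R S)) →ₗ[R]
      (S ⧸ Ideal.span {algebraMap R S x}) ⧸ LinearMap.range (quotientMap S x) :=
    Submodule.mapQ _ _ ((Ideal.span {algebraMap R S x}).mkQ.restrictScalars R) (by
      rintro _ ⟨r, rfl⟩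
      exact ⟨Submodule.Quotient.mk r, rfl⟩)
  have hq : SES (LinearMap.lsmul R (S ⧸ LinearMap.range (Algebra.linearMap R S)) x) q := by
    refine ⟨Module.Flat.isSMulRegular_of_nonZeroDivisors (mem_nonZeroDivisors_iff.mpr
      ⟨fun z hz => hx.right_eq_zero_of_smul hz, fun z hz =>
      hx.right_eq_zero_of_smul (by rwa [smul_eq_mul, mul_comm])⟩), fun z => ?_, ?_⟩
    · obtain ⟨s, rfl⟩ := Submodule.Quotient.mk_surjective _ z
      constructor
      · intro hz
        obtain ⟨r, hr⟩ := (Submodule.Quotient.mk_eq_zero _).mp hz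
        obtain ⟨r, rfl⟩ := Submodule.Quotient.mk_surjective _ r
        have h1 : s - algebraMap R S r ∈ Ideal.span {algebraMap R S x} :=
          (Submodule.Quotient.eq _).mp hr.symm
        obtain ⟨t, ht⟩ := Ideal.mem_span_singleton.mp h1
        refine ⟨Submodule.Quotient.mk t, ?_⟩
        rw [LinearMap.lsmul_apply, ← Submodule.Quotient.mk_smul, Algebra.smul_def, ← ht]
        refine (Submodule.Quotient.eq _).mpr ⟨-r, ?_⟩
        simp
      · rintro ⟨w, hw⟩
        rw [← hw]
        obtain ⟨t, rfl⟩ := Submodule.Quotient.mk_surjective _ w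
        have h1 : (Submodule.Quotient.mk (x • t) : S ⧸ Ideal.span {algebraMap R S x}) = 0 := by
          rw [Submodule.Quotient.mk_eq_zero, Algebra.smul_def]
          exact Ideal.mul_mem_right _ _ (Ideal.mem_span_singleton_self _)
        exact (congrArg (LinearMap.range (quotientMap S x)).mkQ h1).trans (_root_.map_zero _)
    · intro z
      obtain ⟨z, rfl⟩ := Submodule.Quotient.mk_surjective _ z
      obtain ⟨z, rfl⟩ := Submodule.Quotient.mk_surjective _ z
      exact ⟨Submodule.Quotient.mk z, rfl⟩
  obtain ⟨w, rfl⟩ := (LCoh.exact_δ J hq i z).mp (hD _ _)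
  rw [hD _ w, _root_.map_zero]

end Comparison

section Completion

lemma exists_lift_adicCompletion {P S : Type} [CommRing P] [CommRing S] (I : Ideal P) (K : Ideal S)
    [IsAdicComplete K S] (φ : P →+* S) (h : I.map φ ≤ K) :
    ∃ F : AdicCompletion I P →+* S, ∀ p, F (algebraMap P _ p) = φ p := by
  have hn (n : ℕ) : I ^ n ≤ (K ^ n).comap φ := by
    rw [← Ideal.map_le_iff_le_comap, Ideal.map_pow]
    exact Ideal.pow_right_mono h n
  let f (n : ℕ) : AdicCompletion I P →+* S ⧸ K ^ n :=
    (Ideal.quotientMap (K ^ n) φ (hn n)).comp (AdicCompletion.evalₐ I n : AdicCompletion I P →+* _)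
  have hf {m n : ℕ} (hle : m ≤ n) : (Ideal.Quotient.factorPow K hle).comp (f n) = f m := by
    ext x
    have : Ideal.Quotient.factorPow I hle (AdicCompletion.evalₐ I n x) =
        AdicCompletion.evalₐ I m x := by
      induction x using AdicCompletion.induction_on with
      | _ x =>
      rw [AdicCompletion.evalₐ_mk, AdicCompletion.evalₐ_mk]
      exact AdicCompletion.Ideal.mk_eq_mk I hle x
    change Ideal.Quotient.factorPow K hle (Ideal.quotientMap (K ^ n) φ (hn n) _) =
      Ideal.quotientMap (K ^ m) φ (hn m) (AdicCompletion.evalₐ I m x)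
    rw [← this]
    obtain ⟨y, hy⟩ := Ideal.Quotient.mk_surjective (AdicCompletion.evalₐ I n x)
    change Ideal.Quotient.factorPow K hle
      (Ideal.quotientMap (K ^ n) φ (hn n) (AdicCompletion.evalₐ I n x)) = _
    rw [← hy]
    rfl
  refine ⟨IsAdicComplete.liftRingHom K f hf, fun p => ?_⟩
  refine (IsHausdorff.eq_iff_smodEq (I := K)).mpr fun n => ?_
  rw [SModEq.sub_mem]
  have h1 := IsAdicComplete.mk_liftRingHom K f hf n (algebraMap P _ p)
  have h2 : f n (algebraMap P _ p) = Ideal.Quotient.mk (K ^ n) (φ p) := by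
    change Ideal.quotientMap (K ^ n) φ (hn n) (AdicCompletion.evalₐ I n (algebraMap P _ p)) = _
    rw [AlgHom.commutes]
    rfl
  rw [h2, Ideal.Quotient.eq] at h1
  simpa using h1

lemma isNoetherianRing_of_isAdicComplete {R S : Type} [CommRing R] [IsNoetherianRing R] [CommRing S]
    [Algebra R S] (I : Ideal R) [IsAdicComplete (I.map (algebraMap R S)) S]
    (h : ∀ s : S, ∃ r : R, s - algebraMap R S r ∈ I.map (algebraMap R S)) :
    IsNoetherianRing S := by
  obtain ⟨n, g, hg⟩ := Submodule.fg_iff_exists_fin_generating_family.mp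
    (IsNoetherian.noetherian I)
  let φ : MvPolynomial (Fin n) R →+* S :=
    (MvPolynomial.aeval (fun i => algebraMap R S (g i)) : MvPolynomial (Fin n) R →ₐ[R] S)
  have hφ : (MvPolynomial.idealOfVars (Fin n) R).map φ = I.map (algebraMap R S) := by
    rw [MvPolynomial.idealOfVars, Ideal.map_span, ← hg]
    change _ = Ideal.map _ (Ideal.span _)
    rw [Ideal.map_span, ← Set.range_comp, ← Set.range_comp]
    congr 2
    ext i
    simp [φ]
  obtain ⟨F, hF⟩ := exists_lift_adicCompletion (MvPolynomial.idealOfVars (Fin n) R)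
    (I.map (algebraMap R S)) φ hφ.le
  have : IsNoetherianRing
      (AdicCompletion (MvPolynomial.idealOfVars (Fin n) R) (MvPolynomial (Fin n) R)) :=
    isNoetherianRing_of_ringEquiv _
      (MvPowerSeries.toAdicCompletionAlgEquiv (Fin n) R).toRingEquiv
  have := AdicCompletion.isAdicComplete_self (MvPolynomial.idealOfVars (Fin n) R)
    (MvPolynomial.idealOfVars_fg _ _)
  have hmap : ((MvPolynomial.idealOfVars (Fin n) R).map (algebraMap _ (AdicCompletion
    (MvPolynomial.idealOfVars (Fin n) R) (MvPolynomial (Fin n) R)))).map F =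
      I.map (algebraMap R S) := by
    rw [Ideal.map_map, ← hφ]
    congr 1
    exact RingHom.ext hF
  have : IsHausdorff (((MvPolynomial.idealOfVars (Fin n) R).map (algebraMap _ (AdicCompletion
    (MvPolynomial.idealOfVars (Fin n) R) (MvPolynomial (Fin n) R)))).map F) S := by
    rw [hmap]; infer_instance
  refine isNoetherianRing_of_surjective _ _ F
    (surjective_of_mk_map_comp_surjective
      (I := (MvPolynomial.idealOfVars (Fin n) R).map (algebraMap _ _)) F ?_)
  intro z
  obtain ⟨s, rfl⟩ := Ideal.Quotient.mk_surjective z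
  obtain ⟨r, hr⟩ := h s
  refine ⟨algebraMap (MvPolynomial (Fin n) R) _ (MvPolynomial.C r), ?_⟩
  rw [RingHom.comp_apply, hF, eq_comm, Ideal.Quotient.eq, hmap]
  simpa [φ] using hr

lemma ringKrullDim_eq_of_flat {R S : Type} [CommRing R] [IsNoetherianRing R] [IsLocalRing R]
    [CommRing S] [IsNoetherianRing S] [IsLocalRing S] [Algebra R S] [Module.Flat R S]
    [IsLocalHom (algebraMap R S)]
    (h : maximalIdeal S = (maximalIdeal R).map (algebraMap R S)) :
    ringKrullDim S = ringKrullDim R := by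
  have h1 : (maximalIdeal S).LiesOver (maximalIdeal R) :=
    ⟨((((IsLocalRing.local_hom_TFAE (algebraMap R S)).out 0 4 :)).mp ‹_›).symm⟩
  rw [← maximalIdeal_height_eq_ringKrullDim, ← maximalIdeal_height_eq_ringKrullDim,
    Ideal.height_eq_height_add_of_liesOver_of_hasGoingDown (maximalIdeal R) (maximalIdeal S), ← h,
    Ideal.map_quotient_self]
  have : IsDomain (S ⧸ maximalIdeal S) := inferInstance
  rw [Ideal.height_bot, add_zero]

theorem exists_completion (R : Type) [CommRing R] [IsNoetherianRing R] [IsLocalRing R] :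
    ∃ (S : Type) (_ : CommRing S) (_ : Algebra R S) (_ : IsNoetherianRing S) (_ : IsLocalRing S),
      Module.FaithfullyFlat R S ∧ maximalIdeal S = (maximalIdeal R).map (algebraMap R S) ∧
      (∀ (s : S) (n : ℕ), ∃ r : R, s - algebraMap R S r ∈ maximalIdeal S ^ n) ∧
      IsAdicComplete (maximalIdeal S) S ∧ ringKrullDim S = ringKrullDim R := by
  have hfg : (maximalIdeal R).FG := (maximalIdeal R).fg_of_isNoetherianRing
  have hmax := AdicCompletion.maximalIdeal_eq_map (R := R)
  have happrox (s : AdicCompletion (maximalIdeal R) R) (n : ℕ) : ∃ r : R,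
      s - algebraMap R (AdicCompletion (maximalIdeal R) R) r ∈
        maximalIdeal (AdicCompletion (maximalIdeal R) R) ^ n := by
    have h1 := AdicCompletion.pow_smul_top_eq_ker_eval (M := R) (n := n) hfg
    obtain ⟨r, hr⟩ := Submodule.Quotient.mk_surjective _
      (AdicCompletion.eval (maximalIdeal R) R n s)
    refine ⟨r, ?_⟩
    have h2 : s - algebraMap R (AdicCompletion (maximalIdeal R) R) r ∈
        (AdicCompletion.eval (maximalIdeal R) R n).ker := by
      rw [LinearMap.mem_ker, _root_.map_sub, ← hr, sub_eq_zero]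
      rfl
    rw [← h1, Ideal.smul_top_eq_map, Ideal.map_pow, ← hmax] at h2
    exact h2
  have hc : IsAdicComplete ((maximalIdeal R).map (algebraMap R
    (AdicCompletion (maximalIdeal R) R))) (AdicCompletion (maximalIdeal R) R) :=
    AdicCompletion.isAdicComplete_self _ hfg
  have hN : IsNoetherianRing (AdicCompletion (maximalIdeal R) R) :=
    isNoetherianRing_of_isAdicComplete (maximalIdeal R) fun s => by
      have := happrox s 1
      rwa [pow_one, hmax] at this
  have hflat : Module.Flat R (AdicCompletion (maximalIdeal R) R) := inferInstance
  exact ⟨_, inferInstance, inferInstance, hN, inferInstance,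
    Module.FaithfullyFlat.of_flat_of_isLocalHom, hmax, happrox, inferInstance,
    ringKrullDim_eq_of_flat hmax⟩

end Completion

section Matlis

variable {R : Type} [CommRing R] [IsLocalRing R] {E : Type} [AddCommGroup E] [Module R E]

lemma length_hom_le_one (h : IsInjHull R (maximalIdeal R) E) (M : Type) [AddCommGroup M]
    [Module R M] [IsSimpleModule R M] : Module.length R (M →ₗ[R] E) ≤ 1 := by
  obtain ⟨-, j, hj, hess⟩ := h
  have hsimple := isSimpleModule_iff_toSpanSingleton_surjective.mp ‹IsSimpleModule R M›
  obtain ⟨m, hm⟩ := @exists_ne M hsimple.1 0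
  have hsurj := hsimple.2 m hm
  have hann : ∀ r ∈ maximalIdeal R, r • m = 0 := by
    intro r hr
    obtain ⟨s, hs⟩ | hr0 := em (∃ s : R, s • r • m = m)
    · exfalso
      have hu : IsUnit (1 - s * r) := by
        by_contra hnu
        have h1 := Ideal.mul_mem_left _ s hr
        have h2 : (1 : R) ∈ maximalIdeal R := by
          simpa using Ideal.add_mem _ ((mem_maximalIdeal _).mpr hnu) h1
        exact (Ideal.ne_top_iff_one _).mp (maximalIdeal.isMaximal R).ne_top h2
      have : (1 - s * r) • m = 0 := by rw [sub_smul, one_smul, mul_smul, hs, sub_self]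
      exact hm ((hu.smul_eq_zero).mp this)
    · by_contra hne
      exact hr0 (hsimple.2 (r • m) hne m)
  let ev : (M →ₗ[R] E) →ₗ[R] E := LinearMap.applyₗ m
  have hev : Function.Injective ev := by
    refine (injective_iff_map_eq_zero ev).mpr fun f hf => LinearMap.ext fun z => ?_
    obtain ⟨r, rfl⟩ := hsurj z
    have : f m = 0 := hf
    simp [this]
  have hle : ∀ f, ev f ∈ LinearMap.range j := by
    intro f
    by_cases h0 : ev f = 0
    · rw [h0]
      exact zero_mem _
    obtain ⟨z, hz, hz0⟩ := (Submodule.ne_bot_iff _).mp (hess (Submodule.span R {ev f})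
      (by simpa [Submodule.span_singleton_eq_bot] using h0))
    obtain ⟨r, rfl⟩ := Submodule.mem_span_singleton.mp hz.1
    have hr : IsUnit r := by
      by_contra hnu
      refine hz0 ?_
      have : r • f m = 0 := by
        rw [← _root_.map_smul, hann r ((mem_maximalIdeal _).mpr hnu), _root_.map_zero]
      exact this
    obtain ⟨u, rfl⟩ := hr
    have := Submodule.smul_mem _ (↑u⁻¹ : R) hz.2
    rwa [smul_smul, Units.inv_mul, one_smul] at this
  calc Module.length R (M →ₗ[R] E)
      ≤ Module.length R (LinearMap.range j) :=
        Module.length_le_of_injective (ev.codRestrict _ hle) (fun a b hab =>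
          hev (congrArg Subtype.val hab))
    _ = Module.length R (R ⧸ maximalIdeal R) := (LinearEquiv.ofInjective j hj).length_eq.symm
    _ ≤ 1 := by
      have : IsSimpleModule R (R ⧸ maximalIdeal R) :=
        isSimpleModule_iff_isCoatom.mpr (maximalIdeal.isMaximal R).out
      exact (Module.length_eq_one R _).le

lemma length_hom_le (h : IsInjHull R (maximalIdeal R) E) {M : Type} [AddCommGroup M]
    [Module R M] (hM : IsFiniteLength R M) :
    Module.length R (M →ₗ[R] E) ≤ Module.length R M := by
  induction hM with
  | of_subsingleton => simp [Module.length_eq_zero]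
  | @of_simple_quotient M _ _ N _ _ ih =>
    let f : ((M ⧸ N) →ₗ[R] E) →ₗ[R] (M →ₗ[R] E) := LinearMap.lcomp R E N.mkQ
    let g : (M →ₗ[R] E) →ₗ[R] (N →ₗ[R] E) := LinearMap.lcomp R E N.subtype
    have hf : Function.Injective f := fun a b hab => by
      refine LinearMap.ext fun z => ?_
      obtain ⟨z, rfl⟩ := N.mkQ_surjective z
      exact LinearMap.congr_fun hab z
    have hfg : Function.Exact f g.rangeRestrict := by
      intro φ
      constructor
      · intro hφ
        have h0 : ∀ z ∈ N, φ z = 0 := fun z hz =>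
          LinearMap.congr_fun (congrArg Subtype.val hφ) ⟨z, hz⟩
        exact ⟨N.liftQ φ h0, LinearMap.ext fun z => rfl⟩
      · rintro ⟨φ, rfl⟩
        refine Subtype.ext (LinearMap.ext fun z => ?_)
        have : N.mkQ z.1 = 0 := by simp
        exact (congrArg φ this).trans (_root_.map_zero φ)
    rw [Module.length_eq_add_of_exact f g.rangeRestrict hf g.surjective_rangeRestrict hfg,
      Module.length_eq_add_of_exact N.subtype N.mkQ N.injective_subtype N.mkQ_surjective
        (LinearMap.exact_subtype_mkQ N), add_comm]
    exact add_le_add ((Module.length_le_of_injective _ (Submodule.injective_subtype _)).trans ih)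
      ((length_hom_le_one h (M ⧸ N)).trans (Module.length_eq_one R (M ⧸ N)).ge)

lemma isFiniteLength_quotient [IsNoetherianRing R] (n : ℕ) :
    IsFiniteLength R (R ⧸ maximalIdeal R ^ n) := by
  rw [isFiniteLength_iff_isNoetherian_isArtinian]
  refine ⟨inferInstance, ?_⟩
  obtain hs | hn := subsingleton_or_nontrivial (R ⧸ maximalIdeal R ^ n)
  · infer_instance
  have : IsLocalRing (R ⧸ maximalIdeal R ^ n) :=
    IsLocalRing.of_surjective' (Ideal.Quotient.mk _) Ideal.Quotient.mk_surjective
  have : IsArtinianRing (R ⧸ maximalIdeal R ^ n) := by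
    rw [isArtinianRing_iff_isNilpotent_maximalIdeal]
    refine ⟨n, ?_⟩
    rw [← IsLocalRing.map_maximalIdeal_of_surjective (Ideal.Quotient.mk (maximalIdeal R ^ n))
      Ideal.Quotient.mk_surjective, ← Ideal.map_pow]
    exact Ideal.map_quotient_self _
  exact (isArtinian_of_surjective_algebraMap (R := R ⧸ maximalIdeal R ^ n)
    (S := R) (M := R ⧸ maximalIdeal R ^ n) Ideal.Quotient.mk_surjective)

lemma exists_smul_ne_zero (h : IsInjHull R (maximalIdeal R) E) {I : Ideal R} {r : R} (hr : r ∉ I) :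
    ∃ z : E, (∀ a ∈ I, a • z = 0) ∧ r • z ≠ 0 := by
  obtain ⟨g, hg⟩ := exists_apply_ne_zero h (m := Ideal.Quotient.mk I r)
    (mt Ideal.Quotient.eq_zero_iff_mem.mp hr)
  refine ⟨g (Ideal.Quotient.mk I 1), fun a ha => ?_, ?_⟩
  · rw [← _root_.map_smul]
    have : a • (Ideal.Quotient.mk I 1) = 0 := by
      change Ideal.Quotient.mk I (a * 1) = 0
      rw [mul_one]
      exact Ideal.Quotient.eq_zero_iff_mem.mpr ha
    rw [this, _root_.map_zero]
  · rw [← _root_.map_smul]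
    have : r • (Ideal.Quotient.mk I 1) = Ideal.Quotient.mk I r := by
      change Ideal.Quotient.mk I (r * 1) = _
      rw [mul_one]
    rwa [this]

/-- Endomorphisms of the injective hull act on the elements killed by a power of the maximal
ideal as multiplications. -/
lemma exists_apply_eq_smul [IsNoetherianRing R] (h : IsInjHull R (maximalIdeal R) E)
    (ψ : E →ₗ[R] E) (n : ℕ) :
    ∃ r : R, ∀ z : E, (∀ a ∈ maximalIdeal R ^ n, a • z = 0) → ψ z = r • z := by
  let Q := R ⧸ maximalIdeal R ^ n
  let W := Q →ₗ[R] E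
  let b : Q →ₗ[R] (W →ₗ[R] E) := LinearMap.applyₗ
  have hQ : IsFiniteLength R Q := isFiniteLength_quotient n
  have hQt : Module.length R Q ≠ ⊤ := Module.length_ne_top_iff.mpr hQ
  have hW : Module.length R W ≤ Module.length R Q := length_hom_le h hQ
  have hWf : IsFiniteLength R W :=
    Module.length_ne_top_iff.mp (ne_top_of_le_ne_top hQt hW)
  have hb : Function.Injective b := by
    refine (injective_iff_map_eq_zero b).mpr fun q hq => ?_
    by_contra hne
    obtain ⟨g, hg⟩ := exists_apply_ne_zero h hne
    exact hg (LinearMap.congr_fun hq g)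
  have hsurj : Function.Surjective b := by
    rw [← LinearMap.range_eq_top, ← Submodule.Quotient.subsingleton_iff,
      ← Module.length_eq_zero_iff (R := R)]
    have h1 := Module.length_eq_add_of_exact b (LinearMap.range b).mkQ hb
      (Submodule.mkQ_surjective _) (LinearMap.exact_map_mkQ_range b)
    have h2 : Module.length R (W →ₗ[R] E) ≤ Module.length R Q :=
      (length_hom_le h hWf).trans hW
    rw [h1] at h2
    lift Module.length R Q to ℕ using hQt with k
    by_contra hne
    have h3 : (k : ℕ∞) + 1 ≤ k := (add_le_add_right (Order.one_le_iff_pos.mpr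
      (pos_iff_ne_zero.mpr hne)) _).trans h2
    exact absurd (by exact_mod_cast h3 : k + 1 ≤ k) (by lia)
  let φ : W →ₗ[R] E := ψ ∘ₗ LinearMap.applyₗ (Ideal.Quotient.mk (maximalIdeal R ^ n) 1)
  obtain ⟨q, hq⟩ := hsurj φ
  obtain ⟨r, rfl⟩ := Ideal.Quotient.mk_surjective q
  refine ⟨r, fun z hz => ?_⟩
  let w : W := Submodule.liftQ _ (LinearMap.toSpanSingleton R E z) (fun a ha => hz a ha)
  have hw : ∀ a : R, w (Ideal.Quotient.mk _ a) = a • z := fun a => rfl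
  have h1 : w (Ideal.Quotient.mk _ r) = ψ (w (Ideal.Quotient.mk _ 1)) :=
    LinearMap.congr_fun hq w
  rw [hw, hw, one_smul] at h1
  exact h1.symm

end Matlis

section Completion

variable {R : Type} [CommRing R] {S : Type} [CommRing S]
  [Algebra R S] {K : Ideal S}
  {E : Type} [AddCommGroup E] [Module R E] [Module S E] [IsScalarTower R S E]

lemma algebraMap_mem_pow [IsLocalRing R] (hK : K = (maximalIdeal R).map (algebraMap R S))
    {a : R} {n : ℕ}
    (ha : a ∈ maximalIdeal R ^ n) : algebraMap R S a ∈ K ^ n := by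
  rw [hK, ← Ideal.map_pow]
  exact Ideal.mem_map_of_mem _ ha

/-- Over a complete ring, endomorphisms of the injective hull are multiplications. -/
lemma exists_forall_apply_eq_smul [IsNoetherianRing R] [IsLocalRing R]
    (hK : K = (maximalIdeal R).map (algebraMap R S))
    [IsPrecomplete K S] (h : IsInjHull R (maximalIdeal R) E) (ht : ∀ z : E, z ∈ tors K E)
    (ψ : E →ₗ[R] E) : ∃ s : S, ∀ z, ψ z = s • z := by
  choose r hr using exists_apply_eq_smul h ψ
  have hcauchy : ∀ {k n : ℕ}, k ≤ n → r k - r n ∈ maximalIdeal R ^ k := by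
    intro k n hkn
    by_contra hne
    obtain ⟨z, hz, hz0⟩ := exists_smul_ne_zero h hne
    refine hz0 ?_
    rw [sub_smul, ← hr k z hz, ← hr n z fun a ha => hz a (Ideal.pow_le_pow_right hkn ha), sub_self]
  obtain ⟨s, hs⟩ := IsPrecomplete.prec' (I := K) (M := S) (fun n => algebraMap R S (r n))
    (fun {k n} hkn => by
      rw [SModEq.sub_mem, ← _root_.map_sub, smul_eq_mul, Ideal.mul_top]
      exact algebraMap_mem_pow hK (hcauchy hkn))
  refine ⟨s, fun z => ?_⟩
  obtain ⟨n, hn⟩ := (mem_tors K).mp (ht z)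
  have h1 := hs n
  rw [SModEq.sub_mem, smul_eq_mul, Ideal.mul_top] at h1
  have h2 := hn _ h1
  rw [sub_smul, sub_eq_zero, algebraMap_smul] at h2
  rw [← h2]
  refine hr n z fun a ha => ?_
  rw [← algebraMap_smul S a z]
  exact hn _ (algebraMap_mem_pow hK ha)

lemma map_smul_of_torsion {X : Type} [AddCommGroup X] [Module R X] [Module S X]
    [IsScalarTower R S X] (hS : ∀ (s : S) n, ∃ r, s - algebraMap R S r ∈ K ^ n)
    (hX : ∀ z : X, z ∈ tors K X) (hE : ∀ z : E, z ∈ tors K E) (g : X →ₗ[R] E) (s : S) (z : X) :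
    g (s • z) = s • g z := by
  obtain ⟨n, hn⟩ := (mem_tors K).mp (hX z)
  obtain ⟨n', hn'⟩ := (mem_tors K).mp (hE (g z))
  obtain ⟨r, hr⟩ := hS s (n + n')
  have h1 := hn _ (Ideal.pow_le_pow_right (Nat.le_add_right n n') hr)
  have h2 := hn' _ (Ideal.pow_le_pow_right (Nat.le_add_left n' n) hr)
  rw [sub_smul, sub_eq_zero, algebraMap_smul] at h1 h2
  rw [h1, h2, _root_.map_smul]

/-- An endomorphism-like comparison of two identifications of `X` with the `x`-torsion of the
injective hull `E`. -/
lemma exists_comparison [IsNoetherianRing R] [IsLocalRing R] [IsNoetherianRing S] [IsLocalRing S]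
    (hKm : K = maximalIdeal S) (hK : K = (maximalIdeal R).map (algebraMap R S))
    (hS : ∀ (s : S) n, ∃ r, s - algebraMap R S r ∈ K ^ n)
    [IsPrecomplete K S] (h : IsInjHull R (maximalIdeal R) E) (hE : ∀ z : E, z ∈ tors K E)
    {X : Type} [AddCommGroup X] [Module R X] [Module S X] [IsScalarTower R S X]
    (hX : ∀ z : X, z ∈ tors K X) (x : R)
    (g : X →ₗ[R] E) (hg : Function.Injective g)
    (hgr : LinearMap.range g = Submodule.torsionBy R E x)
    (δ : X →ₗ[S] E) (hδ : LinearMap.range δ = Submodule.torsionBy S E (algebraMap R S x)) :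
    ∃ s : S, (∀ z : X, s • z = 0 ↔ δ z = 0) ∧ (∀ z : X, ∃ w, s • w = z) ∧
      ∀ a, s * a ∈ Ideal.span {algebraMap R S x} → a ∈ Ideal.span {algebraMap R S x} := by
  have hinj := h.1
  obtain ⟨ψ, hψ⟩ := Module.Injective.out (Q := E) g hg (δ.restrictScalars R)
  obtain ⟨s, hs⟩ := exists_forall_apply_eq_smul hK h hE ψ
  have hgs := map_smul_of_torsion hS hX hE g
  have hgδ : ∀ z, g (s • z) = δ z := fun z => by
    rw [hgs, ← hs, hψ]
    rfl
  have hsurj : ∀ z : X, ∃ w, s • w = z := by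
    intro z
    have h1 : g z ∈ LinearMap.range δ := by
      have h2 : g z ∈ Submodule.torsionBy R E x := hgr ▸ ⟨z, rfl⟩
      rw [hδ, Submodule.mem_torsionBy_iff, algebraMap_smul]
      exact (Submodule.mem_torsionBy_iff _ _).mp h2
    obtain ⟨w, hw⟩ := h1
    exact ⟨w, hg ((hgδ w).trans hw)⟩
  refine ⟨s, fun z => ?_, hsurj, fun a ha => ?_⟩
  · rw [← hgδ, _root_.map_eq_zero_iff g hg]
  have hkill : ∀ z : E, x • z = 0 → a • z = 0 := by
    intro z hz
    obtain ⟨z, rfl⟩ : z ∈ LinearMap.range g := by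
      rw [hgr]
      exact (Submodule.mem_torsionBy_iff _ _).mpr hz
    obtain ⟨w, rfl⟩ := hsurj z
    rw [← hgs, smul_smul, mul_comm]
    obtain ⟨b, hb⟩ := Ideal.mem_span_singleton'.mp ha
    have hw : x • w = 0 := by
      refine hg ?_
      have : g w ∈ Submodule.torsionBy R E x := hgr ▸ ⟨w, rfl⟩
      rw [_root_.map_smul, _root_.map_zero]
      exact (Submodule.mem_torsionBy_iff _ _).mp this
    rw [← hb, mul_smul, algebraMap_smul, hw, smul_zero, _root_.map_zero]
  rw [← Ideal.Quotient.eq_zero_iff_mem, ← Submodule.mem_bot S,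
    ← Ideal.iInf_pow_smul_eq_bot_of_isLocalRing K (hKm ▸ (maximalIdeal.isMaximal S).ne_top),
    Submodule.mem_iInf]
  intro n
  obtain ⟨r, hr⟩ := hS a n
  have hmem : r ∈ Ideal.span {x} ⊔ maximalIdeal R ^ n := by
    by_contra hne
    obtain ⟨z, hz, hz0⟩ := exists_smul_ne_zero h hne
    refine hz0 ?_
    have hzn : ∀ t ∈ K ^ n, t • z = 0 := by
      intro t ht
      rw [hK, ← Ideal.map_pow] at ht
      have hle : (maximalIdeal R ^ n).map (algebraMap R S) ≤
          LinearMap.ker (LinearMap.toSpanSingleton S E z) := by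
        rw [Ideal.map_le_iff_le_comap]
        intro b hb
        change algebraMap R S b • z = 0
        rw [algebraMap_smul]
        exact hz b (Ideal.mem_sup_right hb)
      exact hle ht
    have h1 := hzn _ hr
    rw [sub_smul, sub_eq_zero, algebraMap_smul] at h1
    rw [← h1]
    exact hkill z (hz x (Ideal.mem_sup_left (Ideal.mem_span_singleton_self x)))
  obtain ⟨b, hb, c, hc, rfl⟩ := Submodule.mem_sup.mp hmem
  obtain ⟨b, rfl⟩ := Ideal.mem_span_singleton'.mp hb
  have h3 : a - algebraMap R S b * algebraMap R S x ∈ K ^ n := by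
    have := Ideal.add_mem _ hr (algebraMap_mem_pow hK hc)
    rw [_root_.map_add, _root_.map_mul] at this
    convert this using 1
    ring
  have h4 : Ideal.Quotient.mk (Ideal.span {algebraMap R S x}) a =
      (a - algebraMap R S b * algebraMap R S x) •
        Ideal.Quotient.mk (Ideal.span {algebraMap R S x}) 1 := by
    change _ = Ideal.Quotient.mk _ (_ * 1)
    rw [mul_one, Ideal.Quotient.eq, sub_sub_cancel]
    exact Ideal.mul_mem_left _ _ (Ideal.mem_span_singleton_self _)
  rw [h4]
  exact Submodule.smul_mem_smul h3 Submodule.mem_top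

end Completion

section Artinian

variable {A : Type} [CommRing A] (J : Ideal A)
variable {M : Type} [AddCommGroup M] [Module A M]

lemma exists_mem_isSMulRegular [IsNoetherianRing A] [Module.Finite A M] (h : tors J M = ⊥) :
    ∃ y ∈ J, IsSMulRegular M y := by
  have hs : Subsingleton ((A ⧸ J) →ₗ[A] M) := by
    refine subsingleton_of_forall_eq 0 fun f => LinearMap.ext fun a => ?_
    have hmem : ∀ a : A ⧸ J, f a ∈ tors J M := by
      intro a
      refine (mem_tors J).mpr ⟨1, fun r hr => ?_⟩
      rw [pow_one] at hr
      obtain ⟨a, rfl⟩ := Ideal.Quotient.mk_surjective a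
      rw [← _root_.map_smul]
      have : r • Ideal.Quotient.mk J a = 0 := by
        change Ideal.Quotient.mk J (r * a) = 0
        exact Ideal.Quotient.eq_zero_iff_mem.mpr (Ideal.mul_mem_right _ _ hr)
      rw [this, _root_.map_zero]
    have := hmem a
    rwa [h, Submodule.mem_bot] at this
  obtain ⟨y, hy, hreg⟩ := IsSMulRegular.subsingleton_linearMap_iff.mp hs
  rw [Ideal.annihilator_quotient] at hy
  exact ⟨y, hy, hreg⟩

lemma tors_quotient_tors [IsNoetherianRing A] [Module.Finite A M] :
    tors J (M ⧸ tors J M) = ⊥ := by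
  refine (Submodule.eq_bot_iff _).mpr fun z hz => ?_
  obtain ⟨m, rfl⟩ := (tors J M).mkQ_surjective z
  obtain ⟨n, hn⟩ := (mem_tors J).mp hz
  obtain ⟨k, hk⟩ := exists_pow_smul_eq_zero J
    ((isNoetherian_def.mp (inferInstanceAs (IsNoetherian A M))) (tors J M)) le_rfl
  rw [Submodule.mkQ_apply, Submodule.Quotient.mk_eq_zero]
  refine (mem_tors J).mpr ⟨k + n, fun r hr => ?_⟩
  rw [pow_add] at hr
  induction hr using Submodule.mul_induction_on' with
  | mem_mul_mem a ha b hb =>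
    have h1 := hn b hb
    rw [← _root_.map_smul, Submodule.mkQ_apply, Submodule.Quotient.mk_eq_zero] at h1
    rw [mul_smul]
    exact hk a ha _ h1
  | add a _ b _ h1 h2 => rw [add_smul, h1, h2, add_zero]

lemma isArtinian_of_pow_smul_eq_zero [IsNoetherianRing A] [IsLocalRing A] [Module.Finite A M]
    {n : ℕ} (h : ∀ r ∈ maximalIdeal A ^ n, ∀ m : M, r • m = 0) : IsArtinian A M := by
  have hq : IsArtinian A (A ⧸ maximalIdeal A ^ n) :=
    (isFiniteLength_iff_isNoetherian_isArtinian.mp (isFiniteLength_quotient n)).2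
  have key : ∀ U : Submodule A M, U.FG → IsArtinian A U := by
    intro U hU
    induction U, hU using Submodule.fg_induction with
    | singleton m =>
      let f : (A ⧸ maximalIdeal A ^ n) →ₗ[A] M :=
        Submodule.liftQ _ (LinearMap.toSpanSingleton A M m) fun a ha => h a ha m
      have hr : LinearMap.range f = Submodule.span A {m} := by
        rw [show LinearMap.range f = _ from Submodule.range_liftQ _ _ _,
          LinearMap.range_toSpanSingleton]
      rw [← hr]
      exact isArtinian_of_surjective _ f.rangeRestrict f.surjective_rangeRestrict
    | sup U V _ _ hU hV => exact isArtinian_sup U V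
  have := key ⊤ Module.Finite.fg_top
  exact isArtinian_of_surjective _ Submodule.topEquiv.toLinearMap Submodule.topEquiv.surjective

/-- A `y`-power torsion module with Artinian `y`-torsion submodule is Artinian. -/
lemma isArtinian_of_torsionBy {y : A} (h : ∀ m : M, ∃ k : ℕ, y ^ k • m = 0)
    (hy : IsArtinian A (Submodule.torsionBy A M y)) : IsArtinian A M := by
  rw [← monotone_stabilizes_iff_artinian]
  intro f₀
  let f : ℕ → Submodule A M := fun n => OrderDual.ofDual (f₀ n)
  have hf : ∀ {i j}, i ≤ j → f j ≤ f i := fun hij => f₀.monotone hij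
  let B : ℕ → ℕ → Submodule A (Submodule.torsionBy A M y) := fun n k =>
    ((f n).map (LinearMap.lsmul A M (y ^ k))).comap (Submodule.subtype _)
  have hB : ∀ n n' k k', n ≤ n' → k ≤ k' → B n' k' ≤ B n k := by
    rintro n n' k k' hn hk ⟨z, hz⟩ ⟨w, hw, hwz⟩
    obtain ⟨c, rfl⟩ := Nat.exists_eq_add_of_le hk
    refine ⟨y ^ c • w, Submodule.smul_mem _ _ (hf hn hw), ?_⟩
    rw [← hwz, LinearMap.lsmul_apply, LinearMap.lsmul_apply, smul_smul, pow_add]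
  obtain ⟨n₀, hn₀⟩ := IsArtinian.monotone_stabilizes
    (⟨fun n => B n n, fun a b hab => hB a b a b hab hab⟩ :
      ℕ →o (Submodule A (Submodule.torsionBy A M y))ᵒᵈ)
  have hdiag : ∀ n k, n₀ ≤ n → n₀ ≤ k → B n k = B n₀ n₀ := by
    intro n k hn hk
    refine le_antisymm (hB _ _ _ _ hn hk) ?_
    have h1 : B n₀ n₀ = B (max n k) (max n k) := hn₀ (max n k) (hn.trans (le_max_left _ _))
    rw [h1]
    exact hB _ _ _ _ (le_max_left _ _) (le_max_right _ _)
  have hcol : ∀ k, ∃ N, ∀ n, N ≤ n → B N k = B n k := fun k =>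
    IsArtinian.monotone_stabilizes
      (⟨fun n => B n k, fun a b hab => hB a b k k hab le_rfl⟩ :
        ℕ →o (Submodule A (Submodule.torsionBy A M y))ᵒᵈ)
  choose N hN using hcol
  let N₀ := n₀ + ∑ k ∈ Finset.range n₀, N k
  have hall : ∀ k n, N₀ ≤ n → B N₀ k = B n k := by
    intro k n hn
    obtain hk | hk := le_or_gt n₀ k
    · rw [hdiag _ _ (Nat.le_add_right _ _) hk, hdiag _ _ ((Nat.le_add_right _ _).trans hn) hk]
    · have h1 : N k ≤ N₀ := (Finset.single_le_sum (f := N) (fun _ _ => Nat.zero_le _)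
        (Finset.mem_range.mpr hk)).trans (Nat.le_add_left _ _)
      rw [← hN k _ h1, ← hN k _ (h1.trans hn)]
  refine ⟨N₀, fun n hn => ?_⟩
  suffices f N₀ ≤ f n from le_antisymm (α := Submodule A M) this (hf hn)
  have main : ∀ k, ∀ z ∈ f N₀, y ^ k • z = 0 → z ∈ f n := by
    intro k
    induction k with
    | zero =>
      intro z _ hz0
      rw [pow_zero, one_smul] at hz0
      rw [hz0]
      exact zero_mem _
    | succ k ih =>
      intro z hz hz0
      have ht : y ^ k • z ∈ Submodule.torsionBy A M y := by
        rw [Submodule.mem_torsionBy_iff, smul_smul, ← pow_succ', hz0]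
      have h1 : (⟨y ^ k • z, ht⟩ : Submodule.torsionBy A M y) ∈ B N₀ k := ⟨z, hz, rfl⟩
      rw [hall k n hn] at h1
      obtain ⟨w, hw, hwz⟩ := h1
      have h2 : y ^ k • w = y ^ k • z := hwz
      have h3 := ih (z - w) (sub_mem hz (hf hn hw)) (by rw [smul_sub, h2, sub_self])
      rw [← sub_add_cancel z w]
      exact add_mem h3 hw
  intro z hz
  obtain ⟨k, hk⟩ := h z
  exact main k z hz hk

lemma SES.quotSMulTop {y : A} (hy : IsSMulRegular M y) :
    SES (LinearMap.lsmul A M y) (Submodule.mkQ (y • (⊤ : Submodule A M))) := by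
  refine ⟨hy, fun m => ?_, Submodule.mkQ_surjective _⟩
  rw [Submodule.mkQ_apply, Submodule.Quotient.mk_eq_zero, Submodule.mem_smul_pointwise_iff_exists]
  simp

/-- Local cohomology of finite modules is Artinian. -/
theorem isArtinian_LCoh [IsNoetherianRing A] [IsLocalRing A] [Module.Finite A M] (i : ℕ) :
    IsArtinian A (LCoh (maximalIdeal A) i M) := by
  induction i generalizing M with
  | zero =>
    have hfg : (tors (maximalIdeal A) M).FG :=
      (isNoetherian_def.mp (inferInstanceAs (IsNoetherian A M))) _
    obtain ⟨n, hn⟩ := exists_pow_smul_eq_zero (maximalIdeal A) hfg le_rfl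
    have : Module.Finite A (tors (maximalIdeal A) M) := Module.Finite.iff_fg.mpr hfg
    have : IsArtinian A (tors (maximalIdeal A) M) :=
      isArtinian_of_pow_smul_eq_zero (n := n) fun r hr m => Subtype.ext (hn r hr m m.2)
    rw [← range_evalOne] at this
    exact isArtinian_of_injective (evalOne (maximalIdeal A) M).rangeRestrict
      (fun a b hab => evalOne_injective _ (congrArg Subtype.val hab))
  | succ i ih =>
    let J := maximalIdeal A
    let U := tors J M
    have hU : tors J U = ⊤ := eq_top_iff.mpr fun m _ => by
      obtain ⟨n, hn⟩ := (mem_tors J).mp m.2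
      exact (mem_tors J).mpr ⟨n, fun r hr => Subtype.ext (hn r hr)⟩
    have hinj : Function.Injective (LCoh.map J (i + 1) U.mkQ) := by
      refine (injective_iff_map_eq_zero _).mpr fun z hz => ?_
      obtain ⟨w, rfl⟩ := (LCoh.exact_map J (SES.ofSubmodule U) (i + 1) z).mp hz
      rw [LCoh.eq_zero_of_tors J hU i w, _root_.map_zero]
    obtain ⟨y, hy, hreg⟩ := exists_mem_isSMulRegular J (tors_quotient_tors J (M := M))
    have h := SES.quotSMulTop hreg
    have hart := ih (M := QuotSMulTop y (M ⧸ tors J M))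
    have : IsArtinian A (LCoh J (i + 1) (M ⧸ U)) := by
      refine isArtinian_of_torsionBy (y := y) (fun m => ?_) ?_
      · obtain ⟨n, hn⟩ := (mem_tors J).mp (tors_LCoh J (i + 1) m)
        exact ⟨n, hn _ (Ideal.pow_mem_pow hy n)⟩
      · rw [← range_δ J h i]
        exact isArtinian_of_surjective _ (LCoh.δ J h i).rangeRestrict
          (LinearMap.surjective_rangeRestrict _)
    exact isArtinian_of_injective _ hinj

/-- Multiples of an Artinian module by powers of an element stabilize. -/
lemma exists_pow_smul_eq_pow_succ_smul [IsArtinian A M] (y : A) :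
    ∃ k : ℕ, ∀ m : M, ∃ m' : M, y ^ k • m = y ^ (k + 1) • m' := by
  obtain ⟨k, hk⟩ := IsArtinian.monotone_stabilizes
    (⟨fun n => LinearMap.range (LinearMap.lsmul A M (y ^ n)), monotone_nat_of_le_succ fun n => by
      rintro _ ⟨m, rfl⟩
      exact ⟨y • m, by rw [LinearMap.lsmul_apply, LinearMap.lsmul_apply, smul_smul, pow_succ]⟩⟩ :
        ℕ →o (Submodule A M)ᵒᵈ)
  refine ⟨k, fun m => ?_⟩
  have h1 : y ^ k • m ∈ LinearMap.range (LinearMap.lsmul A M (y ^ k)) := ⟨m, rfl⟩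
  have h2 : LinearMap.range (LinearMap.lsmul A M (y ^ k)) =
    LinearMap.range (LinearMap.lsmul A M (y ^ (k + 1))) := hk (k + 1) (Nat.le_succ k)
  rw [h2] at h1
  obtain ⟨m', hm'⟩ := h1
  exact ⟨m', hm'.symm⟩

end Artinian

section PowMap

variable {A : Type} [CommRing A] (J : Ideal A)
variable {M N : Type} [AddCommGroup M] [Module A M] [AddCommGroup N] [Module A N]

/-- Multiplication by `y ^ k` as a map `M / yM → M / y ^ (k + 1) M`. -/
noncomputable def powMap (M : Type) [AddCommGroup M] [Module A M] (y : A) (k : ℕ) :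
    QuotSMulTop y M →ₗ[A] QuotSMulTop (y ^ (k + 1)) M :=
  Submodule.mapQ _ _ (LinearMap.lsmul A M (y ^ k)) fun m hm => by
    obtain ⟨m, -, rfl⟩ := (Submodule.mem_smul_pointwise_iff_exists _ _ _).mp hm
    exact (Submodule.mem_smul_pointwise_iff_exists _ _ _).mpr ⟨m, trivial, by
      rw [LinearMap.lsmul_apply, smul_smul, pow_succ]⟩

lemma mkQ_smul_top_eq_zero {y : A} {m : M} :
    (y • (⊤ : Submodule A M)).mkQ m = 0 ↔ ∃ m', y • m' = m := by
  rw [Submodule.mkQ_apply, Submodule.Quotient.mk_eq_zero, Submodule.mem_smul_pointwise_iff_exists]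
  simp

lemma powMap_mkQ (y : A) (k : ℕ) (m : M) :
    powMap M y k ((y • (⊤ : Submodule A M)).mkQ m) =
      (y ^ (k + 1) • (⊤ : Submodule A M)).mkQ (y ^ k • m) := rfl

lemma powMap_injective {y : A} (hy : IsSMulRegular M y) (k : ℕ) :
    Function.Injective (powMap M y k) := by
  refine (injective_iff_map_eq_zero _).mpr fun z hz => ?_
  obtain ⟨m, rfl⟩ := Submodule.mkQ_surjective _ z
  rw [powMap_mkQ, mkQ_smul_top_eq_zero] at hz
  obtain ⟨m', hm'⟩ := hz
  rw [mkQ_smul_top_eq_zero]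
  refine ⟨m', (hy.pow k) ?_⟩
  simp only [smul_smul, ← pow_succ]
  exact hm'

lemma LCoh.map_powMap_eq_zero {y : A} {k i : ℕ}
    (hk : ∀ z : LCoh J i M, ∃ z' : LCoh J i M, y ^ k • z = y ^ (k + 1) • z') (z : LCoh J i M) :
    LCoh.map J i (powMap M y k) (LCoh.map J i (y • (⊤ : Submodule A M)).mkQ z) = 0 := by
  have h1 : powMap M y k ∘ₗ (y • (⊤ : Submodule A M)).mkQ =
      (y ^ (k + 1) • (⊤ : Submodule A M)).mkQ ∘ₗ LinearMap.lsmul A M (y ^ k) := rfl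
  have h2 : (y ^ (k + 1) • (⊤ : Submodule A M)).mkQ ∘ₗ LinearMap.lsmul A M (y ^ (k + 1)) = 0 :=
    LinearMap.ext fun m => mkQ_smul_top_eq_zero.mpr ⟨m, rfl⟩
  obtain ⟨z', hz'⟩ := hk z
  rw [← LinearMap.comp_apply, ← LCoh.map_comp, h1, LCoh.map_comp, LinearMap.comp_apply,
    LCoh.map_lsmul, hz', ← LCoh.map_lsmul, ← LinearMap.comp_apply, ← LCoh.map_comp, h2,
    LCoh.map_zero, LinearMap.zero_apply]

lemma quotSMulTop_map_injective {f : M →ₗ[A] N} (hf : Function.Injective f) {y : A}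
    (hc : ∀ n, y • n ∈ LinearMap.range f → n ∈ LinearMap.range f) :
    Function.Injective (QuotSMulTop.map y f) := by
  refine (injective_iff_map_eq_zero _).mpr fun z hz => ?_
  obtain ⟨m, rfl⟩ := Submodule.mkQ_surjective _ z
  have hz' : (y • (⊤ : Submodule A N)).mkQ (f m) = 0 := hz
  obtain ⟨n, hn⟩ := mkQ_smul_top_eq_zero.mp hz'
  obtain ⟨m', rfl⟩ := hc n ⟨m, hn.symm⟩
  rw [mkQ_smul_top_eq_zero]
  exact ⟨m', hf ((_root_.map_smul f y m').trans hn)⟩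

/-- Passing from a map `M → N` which kills the image of the connecting homomorphism to a map
`M / yM → N / y ^ (k + 1) N` which vanishes on local cohomology. -/
lemma exists_map_eq_zero_of_δ {f : M →ₗ[A] N} (hf : Function.Injective f) {y : A}
    (hM : IsSMulRegular M y) (hN : IsSMulRegular N y)
    (hc : ∀ n, y • n ∈ LinearMap.range f → n ∈ LinearMap.range f) {e : ℕ}
    (hart : IsArtinian A (LCoh J e N))
    (h : ∀ z, LCoh.map J (e + 1) f (LCoh.δ J (SES.quotSMulTop hM) e z) = 0) :
    ∃ (k : ℕ) (g : QuotSMulTop y M →ₗ[A] QuotSMulTop (y ^ (k + 1)) N),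
      Function.Injective g ∧ ∀ z, LCoh.map J e g z = 0 := by
  obtain ⟨k, hk⟩ := exists_pow_smul_eq_pow_succ_smul (M := LCoh J e N) y
  refine ⟨k, powMap N y k ∘ₗ QuotSMulTop.map y f,
    (powMap_injective hN k).comp (quotSMulTop_map_injective hf hc), fun z => ?_⟩
  have h1 := LCoh.δ_naturality J (SES.quotSMulTop hM) (SES.quotSMulTop hN) f f
    (QuotSMulTop.map y f) (LinearMap.ext fun m => _root_.map_smul f y m) rfl e z
  rw [h] at h1
  obtain ⟨w, hw⟩ := (LCoh.exact_δ J (SES.quotSMulTop hN) e _).mp h1.symm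
  rw [LCoh.map_comp, LinearMap.comp_apply, ← hw]
  exact LCoh.map_powMap_eq_zero J hk w

end PowMap

section Dimension

variable {A : Type} [CommRing A]
variable {M N : Type} [AddCommGroup M] [Module A M] [AddCommGroup N] [Module A N]

lemma LCoh.map_surjective_of_torsion [IsNoetherianRing A] (J : Ideal A) {f : M →ₗ[A] N}
    (hker : LinearMap.ker f ≤ tors J M)
    (hcoker : ∀ n : N, ∃ k : ℕ, ∀ r ∈ J ^ k, r • n ∈ LinearMap.range f) (i : ℕ) :
    Function.Surjective (LCoh.map J (i + 1) f) := by
  have h1 : Function.Surjective (LCoh.map J (i + 1) f.rangeRestrict) := by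
    intro z
    have ht : tors J (LinearMap.ker f.rangeRestrict) = ⊤ := eq_top_iff.mpr fun m _ => by
      have hm : m.1 ∈ LinearMap.ker f := congrArg Subtype.val m.2
      obtain ⟨k, hk⟩ := (mem_tors J).mp (hker hm)
      exact (mem_tors J).mpr ⟨k, fun r hr => Subtype.ext (hk r hr)⟩
    exact (LCoh.exact_δ J (SES.ofSurjective f.surjective_rangeRestrict) (i + 1) z).mp
      (LCoh.eq_zero_of_tors J ht (i + 1) _)
  have h2 : Function.Surjective (LCoh.map J (i + 1) (LinearMap.range f).subtype) := by
    intro z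
    have ht : tors J (N ⧸ LinearMap.range f) = ⊤ := eq_top_iff.mpr fun n _ => by
      obtain ⟨n, rfl⟩ := Submodule.mkQ_surjective _ n
      obtain ⟨k, hk⟩ := hcoker n
      refine (mem_tors J).mpr ⟨k, fun r hr => ?_⟩
      rw [← _root_.map_smul, Submodule.mkQ_apply, Submodule.Quotient.mk_eq_zero]
      exact hk r hr
    exact (LCoh.exact_map J (SES.ofSubmodule (LinearMap.range f)) (i + 1) z).mp
      (LCoh.eq_zero_of_tors J ht i _)
  have h3 : f = (LinearMap.range f).subtype ∘ₗ f.rangeRestrict := rfl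
  rw [h3, LCoh.map_comp]
  exact h2.comp h1

lemma supportDim_lt_of_ker_le_tors [IsLocalRing A] {f : M →ₗ[A] N}
    (hker : LinearMap.ker f ≤ tors (maximalIdeal A) M) {e : ℕ}
    (h : Module.supportDim A N < (e + 1 : ℕ)) : Module.supportDim A M < (e + 1 : ℕ) := by
  by_contra hM
  rw [not_lt] at hM
  refine h.not_ge ?_
  obtain ⟨l, hl⟩ := Order.le_krullDim_iff.mp hM
  have hhead : l.head.1 ∈ Module.support A N := by
    by_contra hN
    refine absurd l.head.2 ?_
    rw [Module.notMem_support_iff'] at hN ⊢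
    obtain ⟨t, ht, htp⟩ : ∃ t ∈ maximalIdeal A, t ∉ l.head.1.asIdeal := by
      let i : Fin (l.length + 1) := ⟨1, by lia⟩
      have h01 : l.head < l i := l.strictMono (show (0 : Fin (l.length + 1)) < i from by
        simp [i, Fin.lt_def])
      have h01' : l.head.1.asIdeal < (l i).1.asIdeal := h01
      obtain ⟨t, ht, htp⟩ := SetLike.exists_of_lt h01'
      exact ⟨t, le_maximalIdeal (l i).1.isPrime.ne_top ht, htp⟩
    intro m
    obtain ⟨r, hr, hrm⟩ := hN (f m)
    obtain ⟨k, hk⟩ := (mem_tors _).mp (hker (x := r • m) (by simpa using hrm))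
    refine ⟨t ^ k * r, fun hmem => ?_, ?_⟩
    · obtain h1 | h1 := l.head.1.isPrime.mem_or_mem hmem
      · exact htp (l.head.1.isPrime.mem_of_pow_mem _ h1)
      · exact hr h1
    · rw [mul_smul]
      exact hk _ (Ideal.pow_mem_pow ht k)
  refine Order.le_krullDim_iff.mpr ⟨LTSeries.mk l.length
    (fun i => ⟨(l i).1, Module.mem_support_mono (l.head_le i) hhead⟩)
    (fun i j hij => l.strictMono hij), hl⟩

lemma tors_eq_top_of_supportDim_le_zero [IsNoetherianRing A] [IsLocalRing A] [Module.Finite A M]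
    (h : Module.supportDim A M ≤ 0) : tors (maximalIdeal A) M = ⊤ := by
  obtain hs | hs := subsingleton_or_nontrivial M
  · exact eq_top_iff.mpr fun m _ => by
      rw [Subsingleton.elim m 0]
      exact zero_mem _
  have h0 : Module.supportDim A M = 0 := by
    refine le_antisymm h ?_
    have := Module.supportDim_ne_bot_of_nontrivial A M
    exact Order.krullDim_nonneg_iff.mpr (Module.nonempty_support_iff.mpr hs).to_subtype
  have h1 := support_of_supportDim_eq_zero A M h0
  rw [Module.support_eq_zeroLocus] at h1
  obtain ⟨n, hn⟩ := Ideal.exists_pow_le_of_le_radical_of_fg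
    ((PrimeSpectrum.zeroLocus_subset_zeroLocus_iff _ _).mp h1.le)
    (IsNoetherian.noetherian (maximalIdeal A))
  exact eq_top_iff.mpr fun m _ => (mem_tors _).mpr
    ⟨n, fun r hr => Module.mem_annihilator.mp (hn hr) m⟩

lemma supportDim_add_one_le {y : A} [IsNoetherianRing A] [IsLocalRing A] [Module.Finite A M]
    (hy : y ∈ maximalIdeal A) (hM : IsSMulRegular M y) {e : ℕ} :
    Module.supportDim A (QuotSMulTop y M) ≤ e ↔ Module.supportDim A M ≤ (e + 1 : ℕ) := by
  rw [← Module.supportDim_quotSMulTop_succ_eq_supportDim hM hy, Nat.cast_add, Nat.cast_one]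
  exact ENat.WithBot.add_le_add_one_right_iff.symm

end Dimension

section Vanishing

variable {A : Type} [CommRing A]

lemma supportDim_lt_zero_of_map_eq_zero [IsNoetherianRing A] [IsLocalRing A] {M N : Type}
    [AddCommGroup M] [Module A M] [AddCommGroup N] [Module A N]
    [Module.Finite A N] {f : M →ₗ[A] N} (hf : Function.Injective f)
    (hd : Module.supportDim A N ≤ 0) (h : ∀ z, LCoh.map (maximalIdeal A) 0 f z = 0) :
    Module.supportDim A M < 0 := by
  have ht := tors_eq_top_of_supportDim_le_zero hd
  have hM : tors (maximalIdeal A) M = ⊤ := eq_top_iff.mpr fun m _ => by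
    obtain ⟨k, hk⟩ := (mem_tors _).mp (ht ▸ Submodule.mem_top : f m ∈ tors (maximalIdeal A) N)
    exact (mem_tors _).mpr ⟨k, fun r hr => hf (by rw [_root_.map_smul, hk r hr, _root_.map_zero])⟩
  have : Subsingleton M := subsingleton_of_forall_eq 0 fun m => by
    obtain ⟨z, rfl⟩ := evalOne_surjective (maximalIdeal A) hM m
    refine hf ?_
    rw [← evalOne_map, h, _root_.map_zero, _root_.map_zero]
  rw [Module.supportDim_eq_bot_of_subsingleton]
  exact WithBot.bot_lt_coe _

/-- The preimage in `N` of the torsion of the cokernel of `f`. -/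
noncomputable def saturation (J : Ideal A) {M N : Type} [AddCommGroup M] [Module A M]
    [AddCommGroup N] [Module A N] (f : M →ₗ[A] N) : Submodule A N :=
  (tors J (N ⧸ LinearMap.range f)).comap (LinearMap.range f).mkQ

lemma mem_saturation (J : Ideal A) {M N : Type} [AddCommGroup M] [Module A M]
    [AddCommGroup N] [Module A N] {f : M →ₗ[A] N} {n : N} :
    n ∈ saturation J f ↔ ∃ k : ℕ, ∀ r ∈ J ^ k, r • n ∈ LinearMap.range f := by
  refine exists_congr fun k => forall₂_congr fun r _ => ?_
  rw [← _root_.map_smul, Submodule.mkQ_apply, Submodule.Quotient.mk_eq_zero]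

/-- There is an element regular on `N` and on the quotient by the saturation of `f`. -/
lemma exists_regular_saturation [IsNoetherianRing A] {M N : Type} [AddCommGroup M] [Module A M]
    [AddCommGroup N] [Module A N] [Module.Finite A N] (f : M →ₗ[A] N)
    (J : Ideal A) (hN : tors J N = ⊥) :
    ∃ y ∈ J, IsSMulRegular N y ∧ ∀ n, y • n ∈ saturation J f → n ∈ saturation J f := by
  let C := (N ⧸ LinearMap.range f) ⧸ tors J (N ⧸ LinearMap.range f)
  have ht : tors J (N × C) = ⊥ := by
    refine (Submodule.eq_bot_iff _).mpr ?_
    rintro ⟨n, c⟩ hz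
    obtain ⟨k, hk⟩ := (mem_tors J).mp hz
    have h1 : n ∈ tors J N := (mem_tors J).mpr ⟨k, fun r hr => congrArg Prod.fst (hk r hr)⟩
    have h2 : c ∈ tors J C := (mem_tors J).mpr ⟨k, fun r hr => congrArg Prod.snd (hk r hr)⟩
    rw [hN, Submodule.mem_bot] at h1
    rw [tors_quotient_tors, Submodule.mem_bot] at h2
    rw [h1, h2]
    rfl
  obtain ⟨y, hy, hreg⟩ := exists_mem_isSMulRegular J ht
  refine ⟨y, hy, fun a b hab => ?_, fun n hn => ?_⟩
  · have := @hreg (a, 0) (b, 0) (Prod.ext hab rfl)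
    exact congrArg Prod.fst this
  · have h1 : y • (tors J (N ⧸ LinearMap.range f)).mkQ ((LinearMap.range f).mkQ n) = 0 := by
      rw [← _root_.map_smul, ← _root_.map_smul, Submodule.mkQ_apply, Submodule.Quotient.mk_eq_zero]
      exact hn
    have h2 := @hreg (0, (tors J (N ⧸ LinearMap.range f)).mkQ ((LinearMap.range f).mkQ n)) 0
      (Prod.ext (by simp) (by simpa using h1))
    have h3 : (tors J (N ⧸ LinearMap.range f)).mkQ ((LinearMap.range f).mkQ n) = 0 :=
      congrArg Prod.snd h2
    rw [Submodule.mkQ_apply, Submodule.Quotient.mk_eq_zero] at h3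
    exact h3

/-- An injection which vanishes on top local cohomology has a source of smaller dimension. -/
theorem supportDim_lt_of_map_eq_zero [IsNoetherianRing A] [IsLocalRing A] (e : ℕ)
    {M N : Type} [AddCommGroup M] [Module A M] [AddCommGroup N] [Module A N]
    [Module.Finite A N] {f : M →ₗ[A] N} (hf : Function.Injective f)
    (hd : Module.supportDim A N ≤ e) (h : ∀ z, LCoh.map (maximalIdeal A) e f z = 0) :
    Module.supportDim A M < e := by
  induction e generalizing M N with
  | zero => exact supportDim_lt_zero_of_map_eq_zero hf hd h
  | succ e ih =>
    let J := maximalIdeal A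
    let π : N →ₗ[A] N ⧸ tors J N := (tors J N).mkQ
    have htors : tors J (N ⧸ tors J N) = ⊥ := tors_quotient_tors J
    let U := saturation J (π ∘ₗ f)
    have hU : ∀ m, (π ∘ₗ f) m ∈ U := fun m =>
      (mem_saturation J).mpr ⟨0, fun r _ => ⟨r • m, _root_.map_smul _ r m⟩⟩
    let c : M →ₗ[A] U := (π ∘ₗ f).codRestrict U hU
    have hker : LinearMap.ker c ≤ tors J M := by
      intro m hm
      have h1 : π (f m) = 0 := congrArg Subtype.val hm
      rw [Submodule.mkQ_apply, Submodule.Quotient.mk_eq_zero] at h1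
      obtain ⟨k, hk⟩ := (mem_tors J).mp h1
      exact (mem_tors J).mpr ⟨k, fun r hr =>
        hf (by rw [_root_.map_smul, hk r hr, _root_.map_zero])⟩
    have hcsurj : Function.Surjective (LCoh.map J (e + 1) c) := by
      refine LCoh.map_surjective_of_torsion J hker (fun u => ?_) e
      obtain ⟨k, hk⟩ := (mem_saturation J).mp u.2
      refine ⟨k, fun r hr => ?_⟩
      obtain ⟨m, hm⟩ := hk r hr
      exact ⟨m, Subtype.ext hm⟩
    have hUz : ∀ z, LCoh.map J (e + 1) U.subtype z = 0 := by
      intro z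
      obtain ⟨w, rfl⟩ := hcsurj z
      have h1 : U.subtype ∘ₗ c = π ∘ₗ f := rfl
      rw [← LinearMap.comp_apply, ← LCoh.map_comp, h1, LCoh.map_comp, LinearMap.comp_apply, h,
        _root_.map_zero]
    refine supportDim_lt_of_ker_le_tors hker ?_
    obtain ⟨y, hy, hreg, hcok⟩ := exists_regular_saturation (π ∘ₗ f) J htors
    have hregU : IsSMulRegular U y := fun a b hab => Subtype.ext (hreg (congrArg Subtype.val hab))
    obtain ⟨k, g, hg, hgz⟩ := exists_map_eq_zero_of_δ J U.injective_subtype hregU hreg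
      (fun n hn => by
        rw [Submodule.range_subtype] at hn ⊢
        exact hcok n hn) (isArtinian_LCoh e) (fun z => hUz _)
    have hdN : Module.supportDim A (QuotSMulTop (y ^ (k + 1)) (N ⧸ tors J N)) ≤ e := by
      rw [supportDim_add_one_le (Ideal.pow_mem_of_mem _ hy _ (Nat.succ_pos k)) (hreg.pow _)]
      exact (Module.supportDim_le_of_surjective _ (tors J N).mkQ_surjective).trans hd
    have hlt := ih hg hdN hgz
    rw [← Module.supportDim_quotSMulTop_succ_eq_supportDim hregU hy, Nat.cast_add, Nat.cast_one,
      ENat.WithBot.lt_add_one_iff]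
    exact ENat.WithBot.add_one_le_natCast_iff.mpr hlt

end Vanishing

section Unit

variable {A : Type} [CommRing A]

lemma exists_eq_pow_mul {x s : A} (hx : IsSMulRegular A x)
    (hs : ∀ a b, s * a = x * b → ∃ c, a = x * c) (n : ℕ) (a b : A) (h : s * a = x ^ n * b) :
    ∃ c, a = x ^ n * c := by
  induction n generalizing a b with
  | zero => exact ⟨a, by rw [pow_zero, one_mul]⟩
  | succ n ih =>
    obtain ⟨c, rfl⟩ := hs a (x ^ n * b) (by rw [h]; ring)
    obtain ⟨c', rfl⟩ := ih c b (hx (by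
      change x * (s * c) = x * (x ^ n * b)
      linear_combination h))
    exact ⟨c', by ring⟩

lemma isSMulRegular_quotSMulTop_pow {x s : A} (hx : IsSMulRegular A x)
    (hs : ∀ a b, s * a = x * b → ∃ c, a = x * c) (n : ℕ) :
    IsSMulRegular (QuotSMulTop (x ^ n) A) s := by
  rw [isSMulRegular_iff_right_eq_zero_of_smul]
  intro z hz
  obtain ⟨a, rfl⟩ := Submodule.mkQ_surjective _ z
  rw [← _root_.map_smul, mkQ_smul_top_eq_zero] at hz
  obtain ⟨b, hb⟩ := hz
  obtain ⟨c, hc⟩ := exists_eq_pow_mul hx hs n a b hb.symm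
  exact mkQ_smul_top_eq_zero.mpr ⟨c, hc.symm⟩

lemma mem_range_powMap_of_smul_mem {x s : A} (hx : IsSMulRegular A x)
    (hs : ∀ a b, s * a = x * b → ∃ c, a = x * c) (k : ℕ) (n : QuotSMulTop (x ^ (k + 1)) A)
    (hn : s • n ∈ LinearMap.range (powMap A x k)) : n ∈ LinearMap.range (powMap A x k) := by
  obtain ⟨z, hz⟩ := hn
  obtain ⟨a, rfl⟩ := Submodule.mkQ_surjective _ n
  obtain ⟨b, rfl⟩ := Submodule.mkQ_surjective _ z
  rw [powMap_mkQ, ← _root_.map_smul, ← sub_eq_zero, ← map_sub, mkQ_smul_top_eq_zero] at hz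
  obtain ⟨t, ht⟩ := hz
  simp only [smul_eq_mul] at ht
  obtain ⟨c, rfl⟩ := exists_eq_pow_mul hx hs k a (b - x * t) (by linear_combination ht)
  exact ⟨(x • (⊤ : Submodule A A)).mkQ c, rfl⟩

variable [IsNoetherianRing A] [IsLocalRing A]

/-- An element which is regular modulo `x`, and whose torsion in the top local cohomology of
`A / xA` is the kernel of the connecting homomorphism, is a unit. -/
theorem isUnit_of_smul_eq_zero_iff {x s : A} (hx : IsSMulRegular A x)
    (hxJ : x ∈ maximalIdeal A) {e : ℕ} (hd : Module.supportDim A A = (e + 1 : ℕ))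
    (hs : ∀ a b, s * a = x * b → ∃ c, a = x * c)
    (h : ∀ z : LCoh (maximalIdeal A) e (QuotSMulTop x A),
      s • z = 0 ↔ LCoh.δ (maximalIdeal A) (SES.quotSMulTop hx) e z = 0) : IsUnit s := by
  by_contra hu
  have hsJ : s ∈ maximalIdeal A := hu
  have hN : IsSMulRegular (QuotSMulTop x A) s := by
    have := isSMulRegular_quotSMulTop_pow hx hs 1
    rwa [pow_one] at this
  have hxd := Module.supportDim_quotSMulTop_succ_eq_supportDim hx hxJ
  have hNd := Module.supportDim_quotSMulTop_succ_eq_supportDim hN hsJ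
  rw [hd, Nat.cast_add, Nat.cast_one, ENat.WithBot.add_one_cancel] at hxd
  rw [hxd] at hNd
  cases e with
  | zero =>
    revert hNd
    generalize Module.supportDim A (QuotSMulTop s (QuotSMulTop x A)) = t
    intro hNd
    have h0 : t + 1 ≤ 0 := hNd.le
    rw [show (0 : WithBot ℕ∞) = ((0 : ℕ) : WithBot ℕ∞) from rfl,
      ENat.WithBot.add_one_le_natCast_iff] at h0
    have : t = ⊥ := by
      induction t using WithBot.recBotCoe with
      | bot => rfl
      | coe t => exact absurd h0 (by simp)
    subst this
    simp at hNd
  | succ e =>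
    have : IsArtinian A (LCoh (maximalIdeal A) (e + 1) A) := isArtinian_LCoh (e + 1)
    obtain ⟨k, hk⟩ := exists_pow_smul_eq_pow_succ_smul
      (M := LCoh (maximalIdeal A) (e + 1) A) x
    obtain ⟨n, g, hg, hg0⟩ := exists_map_eq_zero_of_δ (maximalIdeal A)
      (powMap_injective hx k) hN (isSMulRegular_quotSMulTop_pow hx hs (k + 1))
      (mem_range_powMap_of_smul_mem hx hs k) (e := e) (isArtinian_LCoh e) fun z => by
        have h1 : LCoh.δ (maximalIdeal A) (SES.quotSMulTop hN) e z ∈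
            Submodule.torsionBy A _ s := by
          rw [← range_δ (maximalIdeal A) (SES.quotSMulTop hN) e]
          exact ⟨z, rfl⟩
        obtain ⟨w, hw⟩ := (LCoh.exact_δ (maximalIdeal A) (SES.quotSMulTop hx) (e + 1) _).mp
          ((h _).mp ((Submodule.mem_torsionBy_iff _ _).mp h1))
        rw [← hw]
        exact LCoh.map_powMap_eq_zero (maximalIdeal A) hk w
    have hB : Module.supportDim A
        (QuotSMulTop (s ^ (n + 1)) (QuotSMulTop (x ^ (k + 1)) A)) ≤ e := by
      rw [supportDim_add_one_le (Ideal.pow_mem_of_mem _ hsJ _ n.succ_pos)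
        ((isSMulRegular_quotSMulTop_pow hx hs (k + 1)).pow _),
        supportDim_add_one_le (Ideal.pow_mem_of_mem _ hxJ _ k.succ_pos) (hx.pow _), hd]
    have hlt := supportDim_lt_of_map_eq_zero e hg hB hg0
    rw [Nat.cast_add, Nat.cast_one, ENat.WithBot.add_one_cancel] at hNd
    exact hlt.ne hNd

/-- Under the hypotheses on `s` of `isUnit_of_smul_eq_zero_iff`, the element `x` acts surjectively
on the local cohomology below the top degree. -/
theorem surjective_lsmul_of_smul_eq_zero_iff {x s : A} (hx : IsSMulRegular A x)
    (hxJ : x ∈ maximalIdeal A) {e : ℕ} (hd : Module.supportDim A A = (e + 1 : ℕ))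
    (hs : ∀ a b, s * a = x * b → ∃ c, a = x * c)
    (h : ∀ z : LCoh (maximalIdeal A) e (QuotSMulTop x A),
      s • z = 0 ↔ LCoh.δ (maximalIdeal A) (SES.quotSMulTop hx) e z = 0) :
    Function.Surjective (LinearMap.lsmul A (LCoh (maximalIdeal A) e A) x) :=
  surjective_of_δ_injective _ (SES.quotSMulTop hx) e <| (injective_iff_map_eq_zero _).mpr
    fun z hz => (isUnit_of_smul_eq_zero_iff hx hxJ hd hs h).smul_eq_zero.mp ((h z).mpr hz)

end Unit

section Main

lemma exists_baseChange_maximalIdeal {R S : Type} [CommRing R] [IsLocalRing R] [CommRing S]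
    [IsLocalRing S] [Algebra R S] [IsNoetherianRing R] [IsNoetherianRing S] [Module.Flat R S]
    (hK : maximalIdeal S = (maximalIdeal R).map (algebraMap R S)) (i : ℕ)
    (N : Type) [AddCommGroup N] [Module R N] [Module S N] [IsScalarTower R S N] :
    ∃ e : LCoh (maximalIdeal S) i N ≃+ LCoh (maximalIdeal R) i N,
      ∀ (r : R) z, e (algebraMap R S r • z) = r • e z := by
  rw [hK]
  exact exists_flat_baseChange (maximalIdeal R) i N

/-- If `R / xR` is quasi-Gorenstein, then `x` acts surjectively on the local cohomology below the
top degree. -/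
theorem surjective_of_isQuasiGorensteinAt_quotient {R : Type} [CommRing R] [IsNoetherianRing R]
    [IsLocalRing R] {x : R} (hx : IsSMulRegular R x) (hxJ : x ∈ maximalIdeal R) {e : ℕ}
    (hd : ringKrullDim R = (e + 1 : ℕ))
    (hd' : ringKrullDim (R ⧸ Ideal.span {x}) = (e : WithBot ℕ∞))
    (hE : IsInjHull R (maximalIdeal R) (LCoh (maximalIdeal R) (e + 1) R))
    (h : IsQuasiGorensteinAt (R ⧸ Ideal.span {x})
      ((maximalIdeal R).map (Ideal.Quotient.mk (Ideal.span {x})))) :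
    Function.Surjective (LinearMap.lsmul R (LCoh (maximalIdeal R) e R) x) := by
  obtain ⟨S, _, _, _, _, _, hK, hS, hcomp, hdS⟩ := exists_completion R
  have hS1 : ∀ s : S, ∃ r : R, s - algebraMap R S r ∈ (maximalIdeal R).map (algebraMap R S) := by
    intro s
    rw [← hK]
    simpa using hS s 1
  let y := algebraMap R S x
  have hyJ : y ∈ maximalIdeal S := by
    rw [hK]
    exact Ideal.mem_map_of_mem _ hxJ
  have hy : IsSMulRegular S y := by
    have : IsSMulRegular S x := Module.Flat.isSMulRegular_of_nonZeroDivisors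
      (mem_nonZeroDivisors_iff.mpr ⟨fun z hz => hx.right_eq_zero_of_smul hz, fun z hz =>
        hx.right_eq_zero_of_smul (by rwa [smul_eq_mul, mul_comm])⟩)
    intro a b hab
    exact this (by simpa [y, Algebra.smul_def] using hab)
  let E := LCoh (maximalIdeal S) (e + 1) S
  let X := LCoh (maximalIdeal S) e (QuotSMulTop y S)
  let _ : Module R E := Module.compHom _ (algebraMap R S)
  let _ : Module R X := Module.compHom _ (algebraMap R S)
  have : IsScalarTower R S E := IsScalarTower.of_algebraMap_smul fun _ _ => rfl
  have : IsScalarTower R S X := IsScalarTower.of_algebraMap_smul fun _ _ => rfl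
  obtain ⟨bE, hbE⟩ := exists_baseChange_maximalIdeal hK (e + 1) S
  let bE' : E ≃ₗ[R] LCoh (maximalIdeal R) (e + 1) S := { bE with map_smul' := hbE }
  have hE' : IsInjHull R (maximalIdeal R) E :=
    isInjHull_of_equiv (LinearEquiv.ofBijective _
      (LCoh.map_linearMap_bijective (maximalIdeal R) hS1 (e + 1)) ≪≫ₗ bE'.symm) hE
  obtain ⟨t⟩ := nonempty_equiv_torsionBy hx hxJ hd' hE' h
  obtain ⟨bX, hbX⟩ := exists_baseChange_maximalIdeal hK e (S ⧸ Ideal.span {y})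
  let q : QuotSMulTop y S ≃ₗ[S] (S ⧸ Ideal.span {y}) :=
    Submodule.quotEquivOfEq _ _ (by
      rw [← Submodule.ideal_span_singleton_smul, smul_eq_mul, Ideal.mul_top])
  let c := LCoh.congr (maximalIdeal S) e q
  let bX' : X ≃ₗ[R] LCoh (maximalIdeal R) e (S ⧸ Ideal.span {y}) :=
    { c.toAddEquiv.trans bX with
      map_smul' := fun r z => (congrArg bX (c.map_smul (algebraMap R S r) z)).trans (hbX r (c z)) }
  let u : X ≃ₗ[R] Submodule.torsionBy R E x := bX' ≪≫ₗ (LinearEquiv.ofBijective _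
    (LCoh.map_quotientMap_bijective (S := S) (maximalIdeal R) hS1 hx e)).symm ≪≫ₗ t
  obtain ⟨s, hs1, -, hs3⟩ := exists_comparison (X := X) rfl hK hS hE'
    (tors_LCoh (maximalIdeal S) (e + 1)) (tors_LCoh (maximalIdeal S) e) x
    ((Submodule.torsionBy R E x).subtype ∘ₗ u.toLinearMap)
    (Subtype.val_injective.comp u.injective)
    (by rw [LinearMap.range_comp, LinearEquiv.range, Submodule.map_top, Submodule.range_subtype])
    (LCoh.δ (maximalIdeal S) (SES.quotSMulTop hy) e)
    (range_δ (maximalIdeal S) (SES.quotSMulTop hy) e)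
  have hsurj := surjective_lsmul_of_smul_eq_zero_iff hy hyJ (e := e)
    (by rw [Module.supportDim_self_eq_ringKrullDim, hdS, hd])
    (fun a b hab => Ideal.mem_span_singleton.mp
      (hs3 a (hab ▸ Ideal.mul_mem_right _ _ (Ideal.mem_span_singleton_self y)))) hs1
  obtain ⟨b, hb⟩ := exists_baseChange_maximalIdeal hK e S
  have hm := LCoh.map_linearMap_bijective (S := S) (maximalIdeal R) hS1 e
  intro z
  obtain ⟨z', hz'⟩ := b.surjective (LCoh.map (maximalIdeal R) e (Algebra.linearMap R S) z)
  obtain ⟨w', rfl⟩ := hsurj z'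
  obtain ⟨w, hw⟩ := hm.2 (b w')
  refine ⟨w, hm.1 ?_⟩
  rw [LinearMap.lsmul_apply, _root_.map_smul, hw, ← hb]
  exact hz'

theorem isQuasiGorensteinAt_quotient_iff {R : Type} [CommRing R] [IsNoetherianRing R]
    [IsLocalRing R] {d : ℕ} (hd : ringKrullDim R = (d : WithBot ℕ∞))
    (hQG : IsQuasiGorensteinAt R (maximalIdeal R)) {x : R} (hxJ : x ∈ maximalIdeal R)
    (hx : IsSMulRegular R x) :
    IsQuasiGorensteinAt (R ⧸ Ideal.span {x})
        ((maximalIdeal R).map (Ideal.Quotient.mk (Ideal.span {x}))) ↔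
      Function.Surjective (LinearMap.lsmul R (LCoh (maximalIdeal R) (d - 1) R) x) := by
  have hq := ringKrullDim_quotient_span_singleton_succ_eq_ringKrullDim hx hxJ
  have hE := isInjHull_of_isQuasiGorensteinAt hd hQG
  rw [hd] at hq
  cases d with
  | zero =>
    exfalso
    have hne : Nontrivial (R ⧸ Ideal.span {x}) := Ideal.Quotient.nontrivial_iff.mpr
      fun htop => (Ideal.span_singleton_le_iff_mem _).mpr hxJ |>.not_gt
        (htop ▸ lt_top_iff_ne_top.mpr (maximalIdeal.isMaximal R).ne_top)
    have h0 : (0 : WithBot ℕ∞) ≤ ringKrullDim (R ⧸ Ideal.span {x}) :=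
      ringKrullDim_nonneg_of_nontrivial
    have h1 : (1 : WithBot ℕ∞) ≤ 0 := by
      calc (1 : WithBot ℕ∞) = 0 + 1 := (zero_add _).symm
        _ ≤ _ := by gcongr
        _ = _ := hq
    exact absurd h1 (by decide)
  | succ e =>
    rw [Nat.cast_add, Nat.cast_one, ENat.WithBot.add_one_cancel] at hq
    exact ⟨surjective_of_isQuasiGorensteinAt_quotient hx hxJ hd hq hE,
      isQuasiGorensteinAt_quotient_of_surjective hx hxJ hq hE⟩

end Main

end TorsExt

theorem stmt6 (R : Type) [CommRing R] [IsNoetherianRing R] [IsLocalRing R] (d : ℕ) (hd : ringKrullDim R = (d : WithBot ℕ∞)) (hQG : IsQuasiGorensteinAt R (maximalIdeal R)) (x : R) (hx : x ∈ maximalIdeal R) (hreg : IsSMulRegular R x) : IsQuasiGorensteinAt (R ⧸ Ideal.span {x}) ((maximalIdeal R).map (Ideal.Quotient.mk (Ideal.span {x}))) ↔ ∀ p ∈ attachedPrimes R ↥(LC R (maximalIdeal R) (d - 1) (ModuleCat.of R R)), x ∉ p := by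
  rw [TorsExt.isQuasiGorensteinAt_quotient_iff hd hQG hx hreg,
    TorsExt.forall_notMem_attachedPrimes_iff]
  let e := TorsExt.lcEquiv (maximalIdeal R) (d - 1) (ModuleCat.of R R)
  refine ⟨fun h z => ?_, fun h z => ?_⟩
  · obtain ⟨w, hw⟩ := h (e z)
    exact ⟨e.symm w, e.injective (by simpa using hw)⟩
  · obtain ⟨w, hw⟩ := h (e.symm z)
    exact ⟨e w, e.symm.injective (by simpa using hw)⟩
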